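/- arXiv:2601.07544 — 5 statements merged into one kernel-verified Lean document; each statement's English description precedes it below -/
import Mathlib

section
/- Let P be a permutation of a full passport (S, wt) and suppose 1 ≤ k < l ≤ N are adjacent in the graph G(P). Then for every i with k < i < l and every j ∈ {1,…,N} with j < k or j > l, the indices i and j are not adjacent in G(P). -/
open Finset

/-- Cumulative sums of a permutation of a weighted finite set:
`cumSum wt P i = H_i = wt s_1 + ⋯ + wt s_i`, where `s_j = P (j-1)` (0-indexed). -/
noncomputable def cumSum {α : Type*} [Fintype α] (wt : α → ℝ)
    (P : Fin (Fintype.card α) ≃ α) (i : ℕ) : ℝ :=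
  ∑ j ∈ Finset.univ.filter (fun j : Fin (Fintype.card α) => (j : ℕ) < i), wt (P j)

/-- `min{H_k, …, H_{l-1}} > max{H_{k-1}, H_l, 0}`: an edge above the axis. -/
def EdgeAbove (H : ℕ → ℝ) (k l : ℕ) : Prop :=
  ∀ i, k ≤ i → i < l → max (max (H (k - 1)) (H l)) 0 < H i

/-- `max{H_k, …, H_{l-1}} < min{H_{k-1}, H_l, 0}`: an edge below the axis. -/
def EdgeBelow (H : ℕ → ℝ) (k l : ℕ) : Prop :=
  ∀ i, k ≤ i → i < l → H i < min (min (H (k - 1)) (H l)) 0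

/-- Indices `k ≠ l` in `{1,…,N}` are adjacent in the graph `G(P)`
(symmetrized adjacency). -/
def AdjIdx (H : ℕ → ℝ) (N k l : ℕ) : Prop :=
  1 ≤ min k l ∧ max k l ≤ N ∧ k ≠ l ∧
    (EdgeAbove H (min k l) (max k l) ∨ EdgeBelow H (min k l) (max k l))

/-- The indices strictly under an edge above the axis are not joined to indices outside it. -/
theorem EdgeAbove.not_crossing {H : ℕ → ℝ} {k l i j : ℕ} (h : EdgeAbove H k l)
    (hki : k < i) (hil : i < l) (hj : j < k ∨ l < j) :
    ¬ (EdgeAbove H (min i j) (max i j) ∨ EdgeBelow H (min i j) (max i j)) := by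
  have hi := h i hki.le hil
  have hi' := h (i - 1) (by omega) (by omega)
  simp only [max_lt_iff] at hi hi'
  rcases hj with hj | hj
  · rw [min_eq_right (by omega), max_eq_left (by omega)]
    rintro (h' | h')
    · have := h' (k - 1) (by omega) (by omega)
      simp only [max_lt_iff] at this
      linarith
    · have := h' (i - 1) (by omega) (by omega)
      simp only [lt_min_iff] at this
      linarith
  · rw [min_eq_left (by omega), max_eq_right (by omega)]
    rintro (h' | h')
    · have := h' l hil.le hj
      simp only [max_lt_iff] at this
      linarith
    · have := h' i le_rfl (by omega)
      simp only [lt_min_iff] at this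
      linarith

theorem edgeAbove_neg_iff {H : ℕ → ℝ} {k l : ℕ} : EdgeAbove (-H) k l ↔ EdgeBelow H k l := by
  simp [EdgeAbove, EdgeBelow]

theorem edgeBelow_neg_iff {H : ℕ → ℝ} {k l : ℕ} : EdgeBelow (-H) k l ↔ EdgeAbove H k l := by
  rw [← edgeAbove_neg_iff, neg_neg]

/-- The indices strictly under an edge below the axis are not joined to indices outside it. -/
theorem EdgeBelow.not_crossing {H : ℕ → ℝ} {k l i j : ℕ} (h : EdgeBelow H k l)
    (hki : k < i) (hil : i < l) (hj : j < k ∨ l < j) :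
    ¬ (EdgeAbove H (min i j) (max i j) ∨ EdgeBelow H (min i j) (max i j)) := by
  have := (edgeAbove_neg_iff.2 h).not_crossing hki hil hj
  rwa [edgeAbove_neg_iff, edgeBelow_neg_iff, or_comm] at this

theorem stmt_2 {α : Type*} [Fintype α] (wt : α → ℝ)
    (hwt : ∀ s, wt s ≠ 0) (hsum : ∑ s, wt s = 0) (hcard : 2 ≤ Fintype.card α)
    (P : Fin (Fintype.card α) ≃ α) (k l : ℕ)
    (hk : 1 ≤ k) (hkl : k < l) (hl : l ≤ Fintype.card α)
    (hadj : AdjIdx (cumSum wt P) (Fintype.card α) k l) :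
    ∀ i j, k < i → i < l → 1 ≤ j → j ≤ Fintype.card α → (j < k ∨ l < j) →
      ¬ AdjIdx (cumSum wt P) (Fintype.card α) i j := by
  obtain ⟨-, -, -, hedge⟩ := hadj
  rw [min_eq_left hkl.le, max_eq_right hkl.le] at hedge
  rintro i j hki hil - - hj ⟨-, -, -, hij⟩
  rcases hedge with h | h
  · exact h.not_crossing hki hil hj hij
  · exact h.not_crossing hki hil hj hij
end

section
/- Let (S, wt) be a decomposable full passport (i.e., some nonempty proper subset of S has zero weight sum). Then |P_+(S)| = |PT_+(S)| + Σ_{(S_0, S_+)} |PT_+(S_0)| · Σ_{𝔭 = {S_1,…,S_n} ∈ 𝔓(S_+)} ((|S_0| + n − 2)! / (|S_0| − 2)!) · ∏_{i=1}^{n} |P_+(S_i)|, where the outer sum ranges over all ordered pairs (S_0, S_+) of disjoint nonempty subsets of S with S_0 ∪ S_+ = S and Σ_{s∈S_0} wt(s) = Σ_{s∈S_+} wt(s) = 0, and 𝔓(S_+) is the set of partitions of S_+ into nonempty blocks each with zero weight sum. -/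
open Finset

/-- Cumulative sums of a permutation (linear ordering) of a finite subset `B`
with respect to the weight `wt`: `cumSumOn wt B P i = H_i`. -/
noncomputable def cumSumOn {α : Type*} (wt : α → ℝ) (B : Finset α)
    (P : Fin B.card ≃ {x // x ∈ B}) (i : ℕ) : ℝ :=
  ∑ j ∈ Finset.univ.filter (fun j : Fin B.card => (j : ℕ) < i), wt (P j : α)

/-- A positive permutation of `B`: all proper cumulative sums are positive. -/
def PosPermOn {α : Type*} (wt : α → ℝ) (B : Finset α)
    (P : Fin B.card ≃ {x // x ∈ B}) : Prop :=
  ∀ i, 1 ≤ i → i ≤ B.card - 1 → 0 < cumSumOn wt B P i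

/-- A tree permutation of `B`: (1) `H_i ≠ 0` for `1 ≤ i ≤ |B|-1`;
(2) whenever `H_{k-1} = H_l > 0` (`1 ≤ k < l ≤ |B|`), `min{H_k,…,H_{l-1}} < H_l`;
(3) whenever `H_{k-1} = H_l < 0` (`1 ≤ k < l ≤ |B|`), `max{H_k,…,H_{l-1}} > H_l`. -/
def TreePermOn {α : Type*} (wt : α → ℝ) (B : Finset α)
    (P : Fin B.card ≃ {x // x ∈ B}) : Prop :=
  (∀ i, 1 ≤ i → i ≤ B.card - 1 → cumSumOn wt B P i ≠ 0) ∧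
  (∀ k l, 1 ≤ k → k < l → l ≤ B.card →
    cumSumOn wt B P (k - 1) = cumSumOn wt B P l → 0 < cumSumOn wt B P l →
    ∃ t, k ≤ t ∧ t < l ∧ cumSumOn wt B P t < cumSumOn wt B P l) ∧
  (∀ k l, 1 ≤ k → k < l → l ≤ B.card →
    cumSumOn wt B P (k - 1) = cumSumOn wt B P l → cumSumOn wt B P l < 0 →
    ∃ t, k ≤ t ∧ t < l ∧ cumSumOn wt B P l < cumSumOn wt B P t)

/-- `|P_+(B, wt)|`: the number of positive permutations of `B`. -/
noncomputable def numPos {α : Type*} (wt : α → ℝ) (B : Finset α) : ℕ :=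
  Nat.card {P : Fin B.card ≃ {x // x ∈ B} // PosPermOn wt B P}

/-- `|PT_+(B, wt)|`: the number of positive tree permutations of `B`. -/
noncomputable def numPosTree {α : Type*} (wt : α → ℝ) (B : Finset α) : ℕ :=
  Nat.card {P : Fin B.card ≃ {x // x ∈ B} // PosPermOn wt B P ∧ TreePermOn wt B P}

/-- `𝔭` is a partition of `S'` into nonempty zero-sum blocks. -/
def IsPart {α : Type*} (wt : α → ℝ) (S' : Finset α) (𝔭 : Finset (Finset α)) : Prop :=
  (∀ B ∈ 𝔭, B.Nonempty) ∧ (∀ B ∈ 𝔭, B ⊆ S') ∧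
  (∀ a ∈ S', ∃! B, B ∈ 𝔭 ∧ a ∈ B) ∧ (∀ B ∈ 𝔭, ∑ s ∈ B, wt s = 0)

/-- `X(𝔭) = ∏_{B ∈ 𝔭} (|B| - 1)!`. -/
def Xval {α : Type*} (𝔭 : Finset (Finset α)) : ℕ :=
  ∏ B ∈ 𝔭, Nat.factorial (B.card - 1)

namespace Passport

/-! ### Words and their weights -/

section Words

variable {α : Type*}

/-- Total weight of a word. -/
noncomputable def weight (wt : α → ℝ) (l : List α) : ℝ := (l.map wt).sum

/-- Every proper nonempty prefix of the word has positive weight. -/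
def IsPositive (wt : α → ℝ) (l : List α) : Prop :=
  ∀ u v, l = u ++ v → u ≠ [] → v ≠ [] → 0 < weight wt u

/-- A nonempty positive word of weight zero. -/
def IsBlock (wt : α → ℝ) (l : List α) : Prop :=
  l ≠ [] ∧ weight wt l = 0 ∧ IsPositive wt l

/-- No infix of the word is a block. -/
def BlockFree (wt : α → ℝ) (l : List α) : Prop :=
  ∀ m, m <:+: l → ¬ IsBlock wt m

/-- A single letter or a block. -/
def IsPiece (wt : α → ℝ) (p : List α) : Prop := p.length = 1 ∨ IsBlock wt p

/-- The letter of a one-letter word. -/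
def toLetter : List α → Option α
  | [a] => some a
  | _ => none

/-- The word formed by the one-letter pieces of `D`. -/
def singles (D : List (List α)) : List α := D.filterMap toLetter

/-- The pieces of `D` which do not consist of one letter. -/
def blocks (D : List (List α)) : List (List α) := D.filter (fun p => p.length ≠ 1)

variable {wt : α → ℝ}

@[simp] lemma weight_nil : weight wt [] = 0 := rfl

@[simp] lemma weight_cons (a : α) (l : List α) : weight wt (a :: l) = wt a + weight wt l := by
  simp [weight]

@[simp] lemma weight_append (u v : List α) :
    weight wt (u ++ v) = weight wt u + weight wt v := by
  simp [weight]

lemma toLetter_eq_some {p : List α} {a : α} : toLetter p = some a ↔ p = [a] := by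
  rcases p with _ | ⟨b, _ | ⟨c, p⟩⟩ <;> simp [toLetter]

lemma toLetter_eq_none {p : List α} : toLetter p = none ↔ p.length ≠ 1 := by
  rcases p with _ | ⟨b, _ | ⟨c, p⟩⟩ <;> simp [toLetter]

@[simp] lemma singles_nil : singles ([] : List (List α)) = [] := rfl

@[simp] lemma singles_append (D E : List (List α)) :
    singles (D ++ E) = singles D ++ singles E := by
  simp [singles]

@[simp] lemma singles_cons_singleton (a : α) (D : List (List α)) :
    singles ([a] :: D) = a :: singles D := by
  simp [singles, toLetter]

lemma singles_cons_of_length {p : List α} (hp : p.length ≠ 1) (D : List (List α)) :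
    singles (p :: D) = singles D := by
  simp [singles, toLetter_eq_none.2 hp]

lemma mem_singles {D : List (List α)} {a : α} : a ∈ singles D ↔ [a] ∈ D := by
  simp [singles, toLetter_eq_some]

lemma two_le_length_of_weight_eq_zero (hwt : ∀ s, wt s ≠ 0) {l : List α} (hl : l ≠ [])
    (h : weight wt l = 0) : 2 ≤ l.length := by
  rcases l with _ | ⟨b, _ | ⟨c, p⟩⟩
  · simp at hl
  · simp [hwt] at h
  · simp

lemma IsBlock.length_ne_one (hwt : ∀ s, wt s ≠ 0) {l : List α} (h : IsBlock wt l) :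
    l.length ≠ 1 := by
  have := two_le_length_of_weight_eq_zero hwt h.1 h.2.1
  omega

lemma IsPiece.isBlock {p : List α} (h : IsPiece wt p) (hp : p.length ≠ 1) : IsBlock wt p :=
  h.resolve_left hp

lemma IsPiece.ne_nil {p : List α} (h : IsPiece wt p) : p ≠ [] := by
  rcases h with h | h
  · rintro rfl
    simp at h
  · exact h.1

lemma weight_flatten {D : List (List α)} (hD : ∀ p ∈ D, IsPiece wt p) :
    weight wt D.flatten = weight wt (singles D) := by
  induction D with
  | nil => rfl
  | cons p D ih =>
    have ih := ih fun q hq => hD q (List.mem_cons_of_mem _ hq)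
    by_cases hp : p.length = 1
    · obtain ⟨a, rfl⟩ := List.length_eq_one_iff.1 hp
      simp [ih]
    · simp [singles_cons_of_length hp, ih, ((hD p (by simp)).isBlock hp).2.1]

lemma flatten_ne_nil {D : List (List α)} (hD : ∀ p ∈ D, IsPiece wt p) (h : D ≠ []) :
    D.flatten ≠ [] := by
  rcases D with _ | ⟨p, D⟩
  · exact absurd rfl h
  · simp [(hD p (by simp)).ne_nil]

lemma isPositive_singles {D : List (List α)} (hD : ∀ p ∈ D, IsPiece wt p)
    (h : IsPositive wt D.flatten) : IsPositive wt (singles D) := by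
  intro u v huv hu hv
  obtain ⟨D₁, D₂, rfl, rfl, rfl⟩ := List.filterMap_eq_append_iff.1 huv
  have h₁ : ∀ p ∈ D₁, IsPiece wt p := fun p hp => hD p (by simp [hp])
  have h₂ : ∀ p ∈ D₂, IsPiece wt p := fun p hp => hD p (by simp [hp])
  have := h D₁.flatten D₂.flatten (by simp)
    (flatten_ne_nil h₁ (by rintro rfl; simp at hu))
    (flatten_ne_nil h₂ (by rintro rfl; simp at hv))
  rwa [weight_flatten h₁] at this

lemma isPositive_flatten {D : List (List α)}
    (hD : ∀ p ∈ D, IsPiece wt p)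
    (hhead : ∃ x M, D = [x] :: M) (hlast : ∃ y M, D = M ++ [[y]])
    (h : IsPositive wt (singles D)) : IsPositive wt D.flatten := by
  have key : ∀ A B, D = A ++ B → A ≠ [] → B ≠ [] → 0 < weight wt A.flatten := by
    rintro A B rfl hA hB
    rw [weight_flatten fun p hp => hD p (by simp [hp])]
    refine h _ _ (singles_append A B) ?_ ?_
    · obtain ⟨x, M, hM⟩ := hhead
      rcases A with _ | ⟨a, A⟩
      · exact absurd rfl hA
      · obtain ⟨rfl, -⟩ := List.cons_eq_cons.1 hM
        simp
    · obtain ⟨y, M, hM⟩ := hlast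
      obtain ⟨B, b, rfl⟩ := List.eq_nil_or_concat' B |>.resolve_left hB
      rw [← List.append_assoc] at hM
      obtain ⟨-, hb⟩ := List.append_inj' hM rfl
      obtain rfl : b = [y] := by simpa using hb
      simp
  intro u v huv hu hv
  rcases List.flatten_eq_append_iff.1 huv with
    ⟨A, B, rfl, rfl, rfl⟩ | ⟨A, b, c, cs, B, hAB, rfl, rfl⟩
  · exact key A B rfl (by rintro rfl; simp at hu) (by rintro rfl; simp at hv)
  · rcases eq_or_ne b [] with rfl | hb
    · simp only [List.append_nil] at hu ⊢
      exact key A _ hAB (by rintro rfl; simp at hu) (by simp)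
    · have hlen : (b ++ c :: cs).length ≠ 1 := by
        have := List.length_pos_iff.2 hb
        simp
        omega
      have hblock := (hD (b ++ c :: cs) (by simp [hAB])).isBlock hlen
      have hA : A ≠ [] := by
        rintro rfl
        obtain ⟨x, M, hM⟩ := hhead
        rw [hAB] at hM
        obtain ⟨hx, -⟩ := List.cons_eq_cons.1 hM
        rw [hx] at hlen
        simp at hlen
      have h₁ := key A _ hAB hA (by simp)
      have h₂ := hblock.2.2 b (c :: cs) rfl hb (by simp)
      rw [weight_append]
      linarith

lemma BlockFree.mono {l m : List α} (h : BlockFree wt l) (hm : m <:+: l) : BlockFree wt m :=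
  fun _ hn => h _ (hn.trans hm)

/-- A prefix which is a block is determined by the word. -/
lemma IsBlock.eq_of_append_eq {b b' r r' : List α} (hb : IsBlock wt b) (hb' : IsBlock wt b')
    (h : b ++ r = b' ++ r') : b = b' := by
  rcases List.append_eq_append_iff.1 h with ⟨c, rfl, -⟩ | ⟨c, rfl, -⟩
  · by_contra hc
    exact (hb'.2.2 b c rfl hb.1 (by rintro rfl; simp at hc)).ne' hb.2.1
  · by_contra hc
    exact (hb.2.2 b' c rfl hb'.1 (by rintro rfl; simp at hc)).ne' hb'.2.1

/-- If the single letters of `D` form a block-free word and `D` begins with a single letter, then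
no prefix of the flattened word is a block. -/
lemma not_isBlock_of_append {x : α} {D : List (List α)} {b r : List α}
    (hD : ∀ p ∈ D, IsPiece wt p) (hfree : BlockFree wt (singles ([x] :: D)))
    (h : x :: D.flatten = b ++ r) : ¬ IsBlock wt b := by
  intro hb
  have hD' : ∀ p ∈ [x] :: D, IsPiece wt p := by
    intro p hp
    rcases List.mem_cons.1 hp with rfl | hp
    · exact Or.inl rfl
    · exact hD p hp
  have key : ∀ A B, [x] :: D = A ++ B → A ≠ [] → ¬ IsBlock wt A.flatten := by
    intro A B hAB hA hblock
    have hA' : ∀ p ∈ A, IsPiece wt p := fun p hp => hD' p (by rw [hAB]; simp [hp])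
    refine hfree (singles A) ⟨[], singles B, ?_⟩ ⟨?_, ?_, isPositive_singles hA' hblock.2.2⟩
    · rw [hAB]
      simp
    · rcases A with _ | ⟨a, A⟩
      · exact absurd rfl hA
      · obtain ⟨rfl, -⟩ := List.cons_eq_cons.1 hAB
        simp
    · rw [← weight_flatten hA', hblock.2.1]
  rcases List.flatten_eq_append_iff.1 (show ([x] :: D).flatten = b ++ r by simpa using h) with
    ⟨A, B, hAB, rfl, rfl⟩ | ⟨A, u, c, cs, B, hAB, rfl, rfl⟩
  · exact key A B hAB (by rintro rfl; simpa using hb.1) hb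
  · rcases eq_or_ne u [] with rfl | hu
    · simp only [List.append_nil] at hb
      exact key A _ hAB (by rintro rfl; simpa using hb.1) hb
    · have hlen : (u ++ c :: cs).length ≠ 1 := by
        have := List.length_pos_iff.2 hu
        simp
        omega
      have hblock := (hD' (u ++ c :: cs) (by rw [hAB]; simp)).isBlock hlen
      have hA : A ≠ [] := by
        rintro rfl
        obtain ⟨hx, -⟩ := List.cons_eq_cons.1 hAB
        rw [← hx] at hlen
        simp at hlen
      have hA' : ∀ p ∈ A, IsPiece wt p := fun p hp => hD' p (by rw [hAB]; simp [hp])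
      have h₁ := hb.2.2 A.flatten u rfl (flatten_ne_nil hA' hA) hu
      have h₂ := hblock.2.2 u (c :: cs) rfl hu (by simp)
      have h₃ := hb.2.1
      rw [weight_append] at h₃
      linarith

/-- A decomposition into pieces with block-free word of single letters is unique. -/
lemma eq_of_flatten_eq {D E : List (List α)}
    (hD : ∀ p ∈ D, IsPiece wt p) (hE : ∀ p ∈ E, IsPiece wt p)
    (hDfree : BlockFree wt (singles D)) (hEfree : BlockFree wt (singles E))
    (h : D.flatten = E.flatten) : D = E := by
  induction D generalizing E with
  | nil =>
    by_contra hne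
    exact flatten_ne_nil hE (Ne.symm hne) (by simpa using h.symm)
  | cons p D ih =>
    rcases E with _ | ⟨q, E⟩
    · exact absurd h (flatten_ne_nil hD (by simp))
    have hD' : ∀ p ∈ D, IsPiece wt p := fun q hq => hD q (List.mem_cons_of_mem _ hq)
    have hE' : ∀ p ∈ E, IsPiece wt p := fun q hq => hE q (List.mem_cons_of_mem _ hq)
    have htail : ∀ (p : List α) D, singles D <:+: singles (p :: D) := fun p D => by
      rw [← List.singleton_append, singles_append]
      exact (List.suffix_append _ _).isInfix
    rw [List.flatten_cons, List.flatten_cons] at h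
    have hpq : p = q := by
      rcases hD p (by simp) with hp | hp <;> rcases hE q (by simp) with hq | hq
      · exact (List.append_inj h (hp.trans hq.symm)).1
      · obtain ⟨x, rfl⟩ := List.length_eq_one_iff.1 hp
        exact absurd hq (not_isBlock_of_append hD' hDfree (by simpa using h))
      · obtain ⟨x, rfl⟩ := List.length_eq_one_iff.1 hq
        exact absurd hp (not_isBlock_of_append hE' hEfree (by simpa using h.symm))
      · exact hp.eq_of_append_eq hq h
    subst hpq
    rw [ih hD' hE' (hDfree.mono (htail _ _)) (hEfree.mono (htail _ _))
      (List.append_cancel_left h)]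

/-- Every word decomposes into pieces with block-free word of single letters. -/
lemma exists_decomposition (hwt : ∀ s, wt s ≠ 0) (l : List α) :
    ∃ D : List (List α), D.flatten = l ∧ (∀ p ∈ D, IsPiece wt p) ∧ BlockFree wt (singles D) := by
  induction l with
  | nil =>
    refine ⟨[], rfl, by simp, fun m hm hb => hb.1 ?_⟩
    simpa using hm
  | cons x l ih =>
    obtain ⟨D, rfl, hD, hfree⟩ := ih
    by_cases h : BlockFree wt (singles ([x] :: D))
    · exact ⟨[x] :: D, by simp, by simpa [IsPiece] using hD, h⟩
    · simp only [BlockFree, not_forall, not_not] at h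
      obtain ⟨m, hm, hblock⟩ := h
      rw [singles_cons_singleton, List.infix_cons_iff] at hm
      rcases hm with hm | hm
      swap
      · exact absurd hblock (hfree m hm)
      rcases m with _ | ⟨x', m⟩
      · exact absurd rfl hblock.1
      obtain ⟨rfl, r, hr⟩ := List.cons_prefix_cons.1 hm
      have hm' : m ≠ [] := by
        rintro rfl
        exact hblock.length_ne_one hwt rfl
      obtain ⟨m, y, rfl⟩ := List.eq_nil_or_concat' m |>.resolve_left hm'
      rw [List.append_assoc] at hr
      obtain ⟨D₁, D₂, rfl, rfl, h₂⟩ := List.filterMap_eq_append_iff.1 hr.symm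
      obtain ⟨D₃, p, D₄, rfl, h₃, hp, rfl⟩ := List.filterMap_eq_cons_iff.1 h₂
      rw [toLetter_eq_some] at hp
      subst hp
      have h₃' : singles D₃ = [] := List.filterMap_eq_nil_iff.2 h₃
      set E := [x'] :: (D₁ ++ D₃ ++ [[y]]) with hE
      have hsE : singles E = x' :: (D₁.filterMap toLetter ++ [y]) := by
        simp [hE, h₃']
        rfl
      have hpieces : ∀ p ∈ E, IsPiece wt p := by
        intro p hp
        simp only [hE, List.mem_cons, List.mem_append, List.not_mem_nil, or_false] at hp
        rcases hp with rfl | (hp | hp) | rfl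
        · exact Or.inl rfl
        · exact hD p (by simp [hp])
        · exact hD p (by simp [hp])
        · exact Or.inl rfl
      rw [← hsE] at hblock
      have hEblock : IsBlock wt E.flatten :=
        ⟨by simp [hE], by rw [weight_flatten hpieces, hblock.2.1],
          isPositive_flatten hpieces ⟨x', _, rfl⟩ ⟨y, [x'] :: (D₁ ++ D₃), by simp [hE]⟩ hblock.2.2⟩
      refine ⟨E.flatten :: D₄, by simp [hE], ?_, ?_⟩
      · intro p hp
        rcases List.mem_cons.1 hp with rfl | hp
        · exact Or.inr hEblock
        · exact hD p (by simp [hp])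
      · rw [singles_cons_of_length (hEblock.length_ne_one hwt)]
        refine hfree.mono ⟨singles D₁ ++ [y], [], ?_⟩
        simp [h₃']

lemma length_eq_singles_add_blocks (D : List (List α)) :
    D.length = (singles D).length + (blocks D).length := by
  induction D with
  | nil => rfl
  | cons p D ih =>
    by_cases hp : p.length = 1
    · obtain ⟨a, rfl⟩ := List.length_eq_one_iff.1 hp
      simp [blocks] at ih ⊢
      omega
    · rw [singles_cons_of_length hp]
      simp [blocks, hp] at ih ⊢
      omega

lemma flatten_perm (D : List (List α)) : D.flatten.Perm (singles D ++ (blocks D).flatten) := by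
  induction D with
  | nil => simp [blocks]
  | cons p D ih =>
    by_cases hp : p.length = 1
    · obtain ⟨a, rfl⟩ := List.length_eq_one_iff.1 hp
      simpa [blocks] using ih
    · rw [singles_cons_of_length hp]
      simp only [blocks, List.flatten_cons, List.filter_cons, hp, ne_eq, not_false_eq_true,
        decide_true, if_true] at ih ⊢
      exact (ih.append_left p).trans (by
        rw [← List.append_assoc, ← List.append_assoc]
        exact List.perm_append_comm.append_right _)

lemma singles_map_singleton (l : List α) : singles (l.map fun a => [a]) = l := by
  induction l with
  | nil => rfl
  | cons a l ih => simp [ih]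

lemma blocks_map_singleton (l : List α) : blocks (l.map fun a => [a]) = [] := by
  simp [blocks]

lemma map_singleton_singles {D : List (List α)} (h : blocks D = []) :
    (singles D).map (fun a => [a]) = D := by
  induction D with
  | nil => rfl
  | cons p D ih =>
    simp only [blocks, List.filter_cons] at h ih
    by_cases hp : p.length = 1
    · obtain ⟨a, rfl⟩ := List.length_eq_one_iff.1 hp
      simp at h
      simp [ih (by simpa using h)]
    · simp [hp] at h

lemma two_le_card_of_sum_eq_zero (hwt : ∀ s, wt s ≠ 0) {S₀ : Finset α} (hS : S₀.Nonempty)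
    (hsum : ∑ s ∈ S₀, wt s = 0) : 2 ≤ S₀.card := by
  by_contra hlt
  have := hS.card_pos
  obtain ⟨a, rfl⟩ := Finset.card_eq_one.1 (show S₀.card = 1 by omega)
  simp [hwt] at hsum

end Words

/-! ### Words as linear orderings -/

section Orderings

variable {α : Type*} [DecidableEq α]

/-- The word `l` lists every element of `B` exactly once. -/
def IsListing (B : Finset α) (l : List α) : Prop := l.Nodup ∧ l.toFinset = B

variable {wt : α → ℝ} {B : Finset α}

lemma IsListing.length_eq {l : List α} (h : IsListing B l) : l.length = B.card := by
  rw [← h.2, List.toFinset_card_of_nodup h.1]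

lemma IsListing.weight_eq {l : List α} (h : IsListing B l) :
    weight wt l = ∑ s ∈ B, wt s := by
  rw [← h.2, List.sum_toFinset _ h.1, weight]

/-- Linear orderings of `B` correspond to words listing `B`. -/
noncomputable def orderingEquiv (B : Finset α) :
    (Fin B.card ≃ {x // x ∈ B}) ≃ {l : List α // IsListing B l} :=
  Equiv.ofBijective
    (fun P => ⟨List.ofFn fun i => (P i : α),
      List.nodup_ofFn.2 (Subtype.val_injective.comp P.injective), by
        ext a
        simp only [List.mem_toFinset, List.mem_ofFn]
        exact ⟨by rintro ⟨i, rfl⟩; exact (P i).2, fun ha => ⟨P.symm ⟨a, ha⟩, by simp⟩⟩⟩)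
    (by
      constructor
      · intro P Q h
        ext i
        exact congrFun (List.ofFn_injective (Subtype.ext_iff.1 h)) i
      · rintro ⟨l, hl⟩
        have hlen := hl.length_eq
        have hmem : ∀ i : Fin B.card, l[(i : ℕ)]'(by omega) ∈ B := fun i =>
          hl.2.subset (List.mem_toFinset.2 (List.getElem_mem _))
        let f : Fin B.card → {x // x ∈ B} := fun i => ⟨l[(i : ℕ)]'(by omega), hmem i⟩
        have hf : Function.Injective f := fun i j hij => by
          have := (hl.1.getElem_inj_iff).1 (Subtype.ext_iff.1 hij)
          exact Fin.ext this
        refine ⟨Equiv.ofBijective f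
          ((Fintype.bijective_iff_injective_and_card f).2 ⟨hf, by simp⟩), ?_⟩
        refine Subtype.ext (List.ext_getElem (by simp [hlen]) fun i h₁ h₂ => ?_)
        simp [f])

lemma coe_orderingEquiv (P : Fin B.card ≃ {x // x ∈ B}) :
    (orderingEquiv B P : List α) = List.ofFn fun i => (P i : α) := rfl

lemma cumSumOn_eq_weight (P : Fin B.card ≃ {x // x ∈ B}) (i : ℕ) :
    cumSumOn wt B P i = weight wt ((orderingEquiv B P : List α).take i) := by
  rw [cumSumOn, weight, List.map_take, coe_orderingEquiv, List.map_ofFn, List.sum_take_ofFn]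
  rfl

lemma posPermOn_iff (P : Fin B.card ≃ {x // x ∈ B}) :
    PosPermOn wt B P ↔ IsPositive wt (orderingEquiv B P : List α) := by
  have hlen := (orderingEquiv B P).2.length_eq
  simp only [PosPermOn, cumSumOn_eq_weight]
  generalize (orderingEquiv B P : List α) = l at hlen ⊢
  constructor
  · rintro h u v rfl hu hv
    have hu := List.length_pos_iff.2 hu
    have hv := List.length_pos_iff.2 hv
    have := h u.length (by omega) (by simp at hlen; omega)
    simpa using this
  · intro h i hi hi'
    refine h (l.take i) (l.drop i) (by simp) ?_ ?_
    · rw [← List.length_pos_iff, List.length_take]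
      omega
    · rw [← List.length_pos_iff, List.length_drop]
      omega

lemma treePermOn_iff (hwt : ∀ s, wt s ≠ 0) (hB : ∑ s ∈ B, wt s = 0)
    (P : Fin B.card ≃ {x // x ∈ B}) (hP : PosPermOn wt B P) :
    TreePermOn wt B P ↔ BlockFree wt (orderingEquiv B P : List α).tail := by
  have hlen := (orderingEquiv B P).2.length_eq
  have hsum := (orderingEquiv B P).2.weight_eq (wt := wt)
  rw [hB] at hsum
  simp only [PosPermOn, TreePermOn, cumSumOn_eq_weight] at hP ⊢
  generalize (orderingEquiv B P : List α) = l at hlen hsum hP ⊢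
  have hnonneg : ∀ i ≤ B.card, 0 ≤ weight wt (l.take i) := by
    intro i hi
    rcases Nat.eq_zero_or_pos i with rfl | hi'
    · simp
    · rcases hi.lt_or_eq with h | rfl
      · exact (hP i hi' (by omega)).le
      · rw [← hlen, List.take_length, hsum]
  constructor
  · rintro ⟨-, h, -⟩ m ⟨s, t, hl⟩ hm
    have hm2 := two_le_length_of_weight_eq_zero hwt hm.1 hm.2.1
    rcases l with _ | ⟨x, l⟩
    · simp at hl
      exact hm.1 hl.2.1
    simp only [List.tail_cons] at hl
    subst hl
    have hs : ∀ j, weight wt ((x :: (s ++ m ++ t)).take (s.length + 1 + j))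
        = wt x + weight wt s + weight wt ((m ++ t).take j) := by
      intro j
      rw [show s.length + 1 + j = (s.length + j) + 1 by omega, List.take_succ_cons,
        List.append_assoc, List.take_length_add_append]
      simp [add_assoc]
    simp only [List.length_cons, List.length_append] at hlen
    have h₀ := hs 0
    have h₁ := hs m.length
    have hpos := hP (s.length + 1 + 0) (by omega) (by omega)
    rw [h₀] at hpos
    simp only [List.take_zero, weight_nil, add_zero, List.take_left', hm.2.1] at h₀ h₁ hpos
    obtain ⟨t', ht, ht', hlt⟩ := h (s.length + 2) (s.length + 1 + m.length) (by omega) (by omega)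
      (by omega) (by rw [h₁]; exact h₀) (by rw [h₁]; exact hpos)
    obtain ⟨j, rfl⟩ := Nat.exists_eq_add_of_le (show s.length + 1 ≤ t' by omega)
    rw [h₁, hs, List.take_append_of_le_length (by omega)] at hlt
    have := hm.2.2 (m.take j) (m.drop j) (by simp)
      (by rw [← List.length_pos_iff, List.length_take]; omega)
      (by rw [← List.length_pos_iff, List.length_drop]; omega)
    linarith
  · intro hfree
    refine ⟨fun i hi hi' => (hP i hi hi').ne', ?_, fun k j _ _ hj _ hneg =>
      absurd hneg (hnonneg j hj).not_gt⟩
    intro k j hk hkj hj heq hpos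
    by_contra! hge
    classical
    have hex : ∃ i, k ≤ i ∧ i ≤ j ∧ weight wt (l.take i) = weight wt (l.take j) :=
      ⟨j, hkj.le, le_rfl, rfl⟩
    obtain ⟨hki, hij, hi⟩ := Nat.find_spec hex
    set i := Nat.find hex
    have hmin : ∀ i' < i, k ≤ i' → weight wt (l.take j) < weight wt (l.take i') := by
      intro i' hi' hk'
      refine lt_of_le_of_ne (hge i' hk' (by omega)) fun h => ?_
      exact Nat.find_min hex hi' ⟨hk', by omega, h.symm⟩
    have hk1 : 1 ≤ k - 1 := by
      by_contra h0
      rw [show k - 1 = 0 by omega] at heq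
      simp at heq
      linarith
    have hsplit : ∀ n, weight wt (l.take (k - 1 + n)) =
        weight wt (l.take (k - 1)) + weight wt ((l.drop (k - 1)).take n) := by
      intro n
      rw [List.take_add, weight_append]
    refine hfree ((l.drop (k - 1)).take (i - (k - 1))) ?_ ⟨?_, ?_, ?_⟩
    · refine (List.take_prefix _ _).isInfix.trans ?_
      rw [show k - 1 = (k - 2) + 1 by omega, ← List.drop_tail]
      exact (List.drop_suffix _ _).isInfix
    · rw [← List.length_pos_iff, List.length_take, List.length_drop]
      omega
    · have := hsplit (i - (k - 1))
      rw [show k - 1 + (i - (k - 1)) = i by omega] at this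
      linarith
    · intro u v huv hu hv
      have hu := List.length_pos_iff.2 hu
      have hv := List.length_pos_iff.2 hv
      have hlen' := congrArg List.length huv
      simp only [List.length_take, List.length_drop, List.length_append] at hlen'
      have hu' : u = (l.drop (k - 1)).take u.length := by
        have := congrArg (List.take u.length) huv
        rw [List.take_take, List.take_left', min_eq_left (by omega)] at this
        · exact this.symm
        · rfl
      have h₁ := hsplit u.length
      rw [← hu'] at h₁
      have h₂ := hmin (k - 1 + u.length) (by omega) (by omega)
      linarith

lemma numPos_eq : numPos wt B = Nat.card {l : List α // IsListing B l ∧ IsPositive wt l} := by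
  refine Nat.card_congr (((orderingEquiv B).subtypeEquiv
    (q := fun l : {l : List α // IsListing B l} => IsPositive wt (l : List α))
    fun P => posPermOn_iff P).trans
    (Equiv.subtypeSubtypeEquivSubtypeInter (IsListing B) (IsPositive wt)))

lemma numPosTree_eq (hwt : ∀ s, wt s ≠ 0) (hB : ∑ s ∈ B, wt s = 0) :
    numPosTree wt B = Nat.card
      {l : List α // IsListing B l ∧ IsPositive wt l ∧ BlockFree wt l.tail} := by
  refine Nat.card_congr (((orderingEquiv B).subtypeEquiv
    (q := fun l : {l : List α // IsListing B l} => IsPositive wt (l : List α) ∧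
      BlockFree wt (l : List α).tail)
    fun P => ?_).trans (Equiv.subtypeSubtypeEquivSubtypeInter (IsListing B)
      (fun l => IsPositive wt l ∧ BlockFree wt l.tail)))
  rw [← posPermOn_iff]
  exact and_congr_right fun hP => treePermOn_iff hwt hB P hP

lemma finite_listings (B : Finset α) (q : List α → Prop) :
    Finite {l : List α // IsListing B l ∧ q l} := by
  have : Finite {l : List α // IsListing B l} := Finite.of_equiv _ (orderingEquiv B)
  exact Finite.of_injective
    (fun l => (⟨l.1, l.2.1⟩ : {l : List α // IsListing B l}))
    fun l l' h => Subtype.ext (by simpa using h)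

end Orderings

/-! ### Decompositions into single letters and blocks -/

section Decompositions

variable {α : Type*} [DecidableEq α]

/-- `D` is a sequence of single letters and blocks, beginning and ending with a single letter; the
single letters form a positive tree ordering of `S₀`, and the blocks are orderings of the members
of `𝔭`. -/
structure IsDecomposition (wt : α → ℝ) (S₀ : Finset α) (𝔭 : Finset (Finset α))
    (D : List (List α)) : Prop where
  isPiece : ∀ p ∈ D, IsPiece wt p
  head : ∃ x M, D = [x] :: M
  last : ∃ y M, D = M ++ [[y]]
  isListing : IsListing S₀ (singles D)
  isPositive : IsPositive wt (singles D)
  blockFree : BlockFree wt (singles D).tail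
  map_blocks : (((blocks D).map List.toFinset : List (Finset α)) : Multiset (Finset α)) = 𝔭.val
  nodup : ∀ p ∈ blocks D, p.Nodup

variable {wt : α → ℝ} {S₀ B : Finset α} {𝔭 : Finset (Finset α)} {D : List (List α)}

lemma IsDecomposition.length_eq (h : IsDecomposition wt S₀ 𝔭 D) :
    D.length = S₀.card + 𝔭.card := by
  have := congrArg Multiset.card h.map_blocks
  simp only [Multiset.coe_card, List.length_map, Finset.card_val] at this
  rw [length_eq_singles_add_blocks, h.isListing.length_eq, this]

lemma IsDecomposition.mem_blocks (h : IsDecomposition wt S₀ 𝔭 D) :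
    B ∈ 𝔭 ↔ ∃ p ∈ D, p.length ≠ 1 ∧ p.toFinset = B := by
  rw [← Finset.mem_val, ← h.map_blocks]
  simp [blocks, and_assoc]

lemma IsDecomposition.toFinset_ne (h : IsDecomposition wt S₀ 𝔭 D) (hB : B ∉ 𝔭)
    (hcard : B.card ≠ 1) {p : List α} (hp : p ∈ D) : p.toFinset ≠ B := by
  rintro rfl
  by_cases hlen : p.length = 1
  · obtain ⟨a, rfl⟩ := List.length_eq_one_iff.1 hlen
    simp at hcard
  · exact hB (h.mem_blocks.2 ⟨p, hp, hlen, rfl⟩)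

lemma isDecomposition_insert_iff {L R : List (List α)} {b : List α} (hB : b.toFinset ∉ 𝔭)
    (hb : IsBlock wt b) (hlen : b.length ≠ 1) (hnd : b.Nodup) :
    IsDecomposition wt S₀ (insert b.toFinset 𝔭) (L ++ b :: R) ↔
      IsDecomposition wt S₀ 𝔭 (L ++ R) ∧ L ≠ [] ∧ R ≠ [] := by
  have hs : singles (L ++ b :: R) = singles (L ++ R) := by
    rw [singles_append, singles_append, singles_cons_of_length hlen]
  have hbl : (blocks (L ++ b :: R)).Perm (b :: blocks (L ++ R)) := by
    simp [blocks, hlen]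
  have hmap : (((blocks (L ++ b :: R)).map List.toFinset : List _) : Multiset (Finset α)) =
      b.toFinset ::ₘ (((blocks (L ++ R)).map List.toFinset : List _) : Multiset (Finset α)) :=
    Multiset.coe_eq_coe.2 (hbl.map _)
  have hval : (insert b.toFinset 𝔭).val = b.toFinset ::ₘ 𝔭.val := Finset.insert_val_of_notMem hB
  constructor
  · intro h
    have hL : L ≠ [] := by
      rintro rfl
      obtain ⟨x, M, hM⟩ := h.head
      obtain ⟨rfl, -⟩ := List.cons_eq_cons.1 hM
      simp at hlen
    have hR : R ≠ [] := by
      rintro rfl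
      obtain ⟨y, M, hM⟩ := h.last
      obtain ⟨-, hy⟩ := List.append_inj' hM rfl
      obtain rfl : b = [y] := by simpa using hy
      simp at hlen
    refine ⟨⟨fun p hp => h.isPiece p ?_, ?_, ?_, hs ▸ h.isListing, hs ▸ h.isPositive,
      hs ▸ h.blockFree, ?_, fun p hp => h.nodup p (hbl.mem_iff.2 (by simp [hp]))⟩, hL, hR⟩
    · rcases List.mem_append.1 hp with hp | hp <;> simp [hp]
    · obtain ⟨x, M, hM⟩ := h.head
      rcases L with _ | ⟨l, L⟩
      · exact absurd rfl hL
      · obtain ⟨rfl, -⟩ := List.cons_eq_cons.1 hM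
        exact ⟨x, L ++ R, rfl⟩
    · obtain ⟨y, M, hM⟩ := h.last
      obtain ⟨R, r, rfl⟩ := List.eq_nil_or_concat' R |>.resolve_left hR
      rw [← List.cons_append, ← List.append_assoc] at hM
      obtain ⟨-, hy⟩ := List.append_inj' hM rfl
      obtain rfl : r = [y] := by simpa using hy
      exact ⟨y, L ++ R, by simp⟩
    · have := h.map_blocks
      rw [hmap, hval] at this
      exact (Multiset.cons_inj_right _).1 this
  · rintro ⟨h, hL, hR⟩
    refine ⟨fun p hp => ?_, ?_, ?_, hs ▸ h.isListing, hs ▸ h.isPositive,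
      hs ▸ h.blockFree, by rw [hmap, hval, h.map_blocks], fun p hp => ?_⟩
    · rcases List.mem_append.1 hp with hp | hp
      · exact h.isPiece p (by simp [hp])
      · rcases List.mem_cons.1 hp with rfl | hp
        · exact Or.inr hb
        · exact h.isPiece p (by simp [hp])
    · obtain ⟨x, M, hM⟩ := h.head
      rcases L with _ | ⟨l, L⟩
      · exact absurd rfl hL
      · obtain ⟨rfl, -⟩ := List.cons_eq_cons.1 hM
        exact ⟨x, L ++ b :: R, rfl⟩
    · obtain ⟨y, M, hM⟩ := h.last
      obtain ⟨R, r, rfl⟩ := List.eq_nil_or_concat' R |>.resolve_left hR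
      rw [← List.append_assoc] at hM
      obtain ⟨-, hy⟩ := List.append_inj' hM rfl
      obtain rfl : r = [y] := by simpa using hy
      exact ⟨y, L ++ b :: R, by simp⟩
    · rcases List.mem_cons.1 (hbl.mem_iff.1 hp) with rfl | hp
      · exact hnd
      · exact h.nodup p hp

/-- Decompositions without blocks are positive tree orderings. -/
noncomputable def decompositionEmptyEquiv (hS : S₀.Nonempty) :
    {D : List (List α) // IsDecomposition wt S₀ ∅ D} ≃
      {l : List α // IsListing S₀ l ∧ IsPositive wt l ∧ BlockFree wt l.tail} where
  toFun D := ⟨singles D.1, D.2.isListing, D.2.isPositive, D.2.blockFree⟩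
  invFun l := ⟨l.1.map fun a => [a], by
    obtain ⟨l, hl, hpos, hfree⟩ := l
    have hne : l ≠ [] := by
      rintro rfl
      have := hl.length_eq
      simp [hS.ne_empty, eq_comm] at this
    refine ⟨?_, ?_, ?_, ?_, ?_, ?_, ?_, ?_⟩
    · simp [IsPiece]
    · rcases l with _ | ⟨a, l⟩
      · exact absurd rfl hne
      · exact ⟨a, _, rfl⟩
    · obtain ⟨l, a, rfl⟩ := List.eq_nil_or_concat' l |>.resolve_left hne
      exact ⟨a, l.map fun a => [a], by simp⟩
    · rwa [singles_map_singleton]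
    · rwa [singles_map_singleton]
    · rwa [singles_map_singleton]
    · simp [blocks_map_singleton]
    · simp [blocks_map_singleton]⟩
  left_inv D := Subtype.ext (map_singleton_singles (by simpa using D.2.map_blocks))
  right_inv l := Subtype.ext (singles_map_singleton _)

/-- A decomposition with one more block arises by inserting an ordering of that block at one of
the inner positions. -/
noncomputable def decompositionInsertEquiv (hwt : ∀ s, wt s ≠ 0) (hB : B ∉ 𝔭)
    (hne : B.Nonempty) (hsum : ∑ s ∈ B, wt s = 0) :
    {D : List (List α) // IsDecomposition wt S₀ 𝔭 D} × Fin (S₀.card + 𝔭.card - 1) ×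
        {l : List α // IsListing B l ∧ IsPositive wt l} ≃
      {D : List (List α) // IsDecomposition wt S₀ (insert B 𝔭) D} := by
  have hblock : ∀ l : List α, IsListing B l → IsPositive wt l → IsBlock wt l := by
    intro l hl hpos
    refine ⟨?_, hl.weight_eq.trans hsum, hpos⟩
    rintro rfl
    exact hne.ne_empty (by simpa using hl.2.symm)
  have hcard : ∀ l : List α, IsListing B l → IsPositive wt l → B.card ≠ 1 := by
    intro l hl hpos
    rw [← hl.length_eq]
    exact (hblock l hl hpos).length_ne_one hwt
  refine Equiv.ofBijective (fun x => ⟨x.1.1.take (x.2.1 + 1) ++ x.2.2.1 :: x.1.1.drop (x.2.1 + 1),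
    ?_⟩) ⟨?_, ?_⟩
  · obtain ⟨⟨D, hD⟩, ⟨i, hi⟩, l, hl, hpos⟩ := x
    have hlen := hD.length_eq
    have hb := hblock l hl hpos
    have := (isDecomposition_insert_iff (S₀ := S₀) (𝔭 := 𝔭) (L := D.take (i + 1))
      (R := D.drop (i + 1)) (by rwa [hl.2]) hb (hb.length_ne_one hwt) hl.1).2
      ⟨by rwa [List.take_append_drop],
        by rw [← List.length_pos_iff, List.length_take]; omega,
        by rw [← List.length_pos_iff, List.length_drop]; omega⟩
    rwa [hl.2] at this
  · rintro ⟨⟨D, hD⟩, ⟨i, hi⟩, l, hl, hpos⟩ ⟨⟨D', hD'⟩, ⟨i', hi'⟩, l', hl', hpos'⟩ h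
    have hlen := hD.length_eq
    have hlen' := hD'.length_eq
    have h := congrArg Subtype.val h
    simp only at h
    rw [List.append_cons_inj_of_notMem] at h
    · obtain ⟨h₁, rfl, h₂⟩ := h
      have h₃ := congrArg List.length h₁
      rw [List.length_take, List.length_take] at h₃
      obtain rfl : i = i' := by omega
      obtain rfl : D = D' := by
        rw [← List.take_append_drop (i + 1) D, h₁, h₂, List.take_append_drop]
      rfl
    · exact fun hmem => hD.toFinset_ne hB (hcard l hl hpos) (List.mem_of_mem_take hmem) hl'.2
    · exact fun hmem => hD.toFinset_ne hB (hcard l hl hpos) (List.mem_of_mem_drop hmem) hl'.2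
  · rintro ⟨D, hD⟩
    obtain ⟨b, hbD, hlen, rfl⟩ := hD.mem_blocks.1 (Finset.mem_insert_self B 𝔭)
    have hb := (hD.isPiece b hbD).isBlock hlen
    have hnd := hD.nodup b (by simp [blocks, hbD, hlen])
    obtain ⟨L, R, rfl⟩ := List.append_of_mem hbD
    obtain ⟨hLR, hL, hR⟩ := (isDecomposition_insert_iff hB hb hlen hnd).1 hD
    have hLRlen := hLR.length_eq
    rw [List.length_append] at hLRlen
    have hL' := List.length_pos_iff.2 hL
    have hR' := List.length_pos_iff.2 hR
    refine ⟨⟨⟨L ++ R, hLR⟩, ⟨L.length - 1, by omega⟩, b, ⟨hnd, rfl⟩, hb.2.2⟩, Subtype.ext ?_⟩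
    simp [Nat.sub_add_cancel hL']

lemma card_decomposition (hwt : ∀ s, wt s ≠ 0) (hS : S₀.Nonempty) (hsum : ∑ s ∈ S₀, wt s = 0)
    (h𝔭 : ∀ B ∈ 𝔭, B.Nonempty ∧ ∑ s ∈ B, wt s = 0) :
    Finite {D : List (List α) // IsDecomposition wt S₀ 𝔭 D} ∧
    Nat.card {D : List (List α) // IsDecomposition wt S₀ 𝔭 D} =
      numPosTree wt S₀ * ((S₀.card - 1).ascFactorial 𝔭.card * ∏ B ∈ 𝔭, numPos wt B) := by
  have hS1 : 1 ≤ S₀.card := hS.card_pos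
  induction 𝔭 using Finset.induction_on with
  | empty =>
    have := finite_listings S₀ fun l => IsPositive wt l ∧ BlockFree wt l.tail
    refine ⟨Finite.of_equiv _ (decompositionEmptyEquiv hS).symm, ?_⟩
    rw [Nat.card_congr (decompositionEmptyEquiv hS), ← numPosTree_eq hwt hsum]
    simp
  | insert B 𝔭 hB ih =>
    obtain ⟨hfin, hcard⟩ := ih fun C hC => h𝔭 C (Finset.mem_insert_of_mem hC)
    obtain ⟨hne, hBsum⟩ := h𝔭 B (Finset.mem_insert_self B 𝔭)
    have := finite_listings B (IsPositive wt)
    have e := decompositionInsertEquiv (S₀ := S₀) hwt hB hne hBsum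
    refine ⟨Finite.of_equiv _ e, ?_⟩
    rw [← Nat.card_congr e, Nat.card_prod, Nat.card_prod, hcard, ← numPos_eq, Nat.card_fin,
      Finset.card_insert_of_notMem hB, Finset.prod_insert hB, Nat.ascFactorial_succ,
      show S₀.card + 𝔭.card - 1 = S₀.card - 1 + 𝔭.card by omega]
    ring

end Decompositions

/-! ### Decomposing positive orderings -/

section Flatten

variable {α : Type*} [DecidableEq α] {wt : α → ℝ} {S₀ : Finset α}
  {𝔭 : Finset (Finset α)} {D : List (List α)}

lemma IsDecomposition.isListing_flatten [Fintype α] (h : IsDecomposition wt S₀ 𝔭 D)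
    (hpart : IsPart wt (Finset.univ \ S₀) 𝔭) : IsListing Finset.univ D.flatten := by
  obtain ⟨-, hsub, huniq, -⟩ := hpart
  have hmem : ∀ p ∈ blocks D, p.toFinset ∈ 𝔭 := fun p hp => by
    simp only [blocks, List.mem_filter, decide_eq_true_eq] at hp
    exact h.mem_blocks.2 ⟨p, hp.1, hp.2, rfl⟩
  have hnot : ∀ p ∈ blocks D, ∀ a ∈ p, a ∈ Finset.univ \ S₀ := fun p hp a ha =>
    hsub _ (hmem p hp) (List.mem_toFinset.2 ha)
  constructor
  · rw [(flatten_perm D).nodup_iff, List.nodup_append']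
    refine ⟨h.isListing.1, List.nodup_flatten.2 ⟨h.nodup, ?_⟩, ?_⟩
    · have hnd : ((blocks D).map List.toFinset).Nodup := by
        rw [← Multiset.coe_nodup, h.map_blocks]
        exact 𝔭.nodup
      refine (List.pairwise_map.1 hnd).imp_of_mem fun {p q} hp hq hne a hap haq => hne ?_
      exact (huniq a (hnot p hp a hap)).unique ⟨hmem p hp, List.mem_toFinset.2 hap⟩
        ⟨hmem q hq, List.mem_toFinset.2 haq⟩
    · intro a ha hb
      obtain ⟨p, hp, hap⟩ := List.mem_flatten.1 hb
      have := hnot p hp a hap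
      rw [← h.isListing.2] at this
      simp [ha] at this
  · refine Finset.eq_univ_of_forall fun a => ?_
    rw [List.mem_toFinset, (flatten_perm D).mem_iff, List.mem_append]
    by_cases ha : a ∈ S₀
    · left
      rwa [← List.mem_toFinset, h.isListing.2]
    · right
      obtain ⟨B, ⟨hB, haB⟩, -⟩ := huniq a (by simp [ha])
      obtain ⟨p, hp, hlen, rfl⟩ := h.mem_blocks.1 hB
      exact List.mem_flatten.2 ⟨p, by simp [blocks, hp, hlen], List.mem_toFinset.1 haB⟩

lemma IsDecomposition.isPart [Fintype α] (h : IsDecomposition wt S₀ 𝔭 D)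
    (hD : IsListing Finset.univ D.flatten) : IsPart wt (Finset.univ \ S₀) 𝔭 := by
  have hnd := hD.1
  rw [(flatten_perm D).nodup_iff, List.nodup_append'] at hnd
  obtain ⟨-, hblocks, hdisj⟩ := hnd
  rw [List.nodup_flatten] at hblocks
  have hmem : ∀ {B}, B ∈ 𝔭 ↔ ∃ p ∈ blocks D, p.toFinset = B := by
    intro B
    simp [h.mem_blocks, blocks, and_assoc]
  refine ⟨?_, ?_, ?_, ?_⟩
  · intro B hB
    obtain ⟨p, hp, hlen, rfl⟩ := h.mem_blocks.1 hB
    exact List.toFinset_nonempty_iff _ |>.2 ((h.isPiece p hp).ne_nil)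
  · intro B hB a ha
    obtain ⟨p, hp, rfl⟩ := hmem.1 hB
    rw [← h.isListing.2]
    simp only [Finset.mem_sdiff, Finset.mem_univ, true_and, List.mem_toFinset] at ha ⊢
    exact fun hs => hdisj hs (List.mem_flatten.2 ⟨p, hp, ha⟩)
  · intro a ha
    have hin : a ∈ D.flatten := by
      rw [← List.mem_toFinset, hD.2]
      exact Finset.mem_univ a
    rw [← h.isListing.2] at ha
    simp only [Finset.mem_sdiff, Finset.mem_univ, true_and, List.mem_toFinset] at ha
    rw [(flatten_perm D).mem_iff, List.mem_append] at hin
    obtain ⟨p, hp, hap⟩ := List.mem_flatten.1 (hin.resolve_left ha)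
    refine ⟨p.toFinset, ⟨hmem.2 ⟨p, hp, rfl⟩, List.mem_toFinset.2 hap⟩, ?_⟩
    rintro B ⟨hB, haB⟩
    obtain ⟨q, hq, rfl⟩ := hmem.1 hB
    by_contra hne
    have : Std.Symm (List.Disjoint (α := α)) := ⟨fun _ _ => List.Disjoint.symm⟩
    exact hblocks.2.forall hq hp (by rintro rfl; exact hne rfl)
      (List.mem_toFinset.1 haB) hap
  · intro B hB
    obtain ⟨p, hp, hlen, rfl⟩ := h.mem_blocks.1 hB
    have hp' : p ∈ blocks D := by simp [blocks, hp, hlen]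
    rw [List.sum_toFinset _ (h.nodup p hp')]
    exact ((h.isPiece p hp).isBlock hlen).2.1

lemma exists_isDecomposition (hwt : ∀ s, wt s ≠ 0) {l : List α} (hl : l ≠ []) (hnd : l.Nodup)
    (hsum : weight wt l = 0) (hpos : IsPositive wt l) :
    ∃ S₀ 𝔭 D, IsDecomposition wt S₀ 𝔭 D ∧ D.flatten = l := by
  rcases l with _ | ⟨x, l⟩
  · exact absurd rfl hl
  obtain ⟨D, rfl, hD, hfree⟩ := exists_decomposition hwt l
  have hpieces : ∀ p ∈ [x] :: D, IsPiece wt p := by simpa [IsPiece] using hD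
  have hflat : ([x] :: D).flatten = x :: D.flatten := by simp
  have hndD : (blocks ([x] :: D)).flatten.Nodup := by
    rw [← hflat, (flatten_perm _).nodup_iff, List.nodup_append'] at hnd
    exact hnd.2.1
  rw [List.nodup_flatten] at hndD
  have hmap : ((blocks ([x] :: D)).map List.toFinset).Nodup := by
    refine List.pairwise_map.2 (hndD.2.imp_of_mem fun {p q} hp hq hdisj heq => ?_)
    have hp' : p ∈ [x] :: D := List.mem_of_mem_filter hp
    obtain ⟨a, ha⟩ := List.exists_mem_of_ne_nil p (hpieces p hp').ne_nil
    exact hdisj ha (by rwa [← List.mem_toFinset, ← heq, List.mem_toFinset])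
  refine ⟨(singles ([x] :: D)).toFinset, ((blocks ([x] :: D)).map List.toFinset).toFinset,
    [x] :: D, ⟨hpieces, ⟨x, D, rfl⟩, ?_, ⟨?_, rfl⟩, ?_, by simpa using hfree, ?_, hndD.1⟩, hflat⟩
  · have hne : D ≠ [] := by
      rintro rfl
      simp [hwt] at hsum
    obtain ⟨D, p, rfl⟩ := List.eq_nil_or_concat' D |>.resolve_left hne
    rcases hpieces p (by simp) with hp | hp
    · obtain ⟨y, rfl⟩ := List.length_eq_one_iff.1 hp
      exact ⟨y, [x] :: D, rfl⟩
    · have h := hpos (x :: D.flatten) p (by simp) (by simp) hp.1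
      have h' := hp.2.1
      simp only [List.flatten_append, List.flatten_cons, List.flatten_nil, List.append_nil,
        weight_cons, weight_append] at h hsum
      linarith
  · rw [← hflat, (flatten_perm _).nodup_iff, List.nodup_append'] at hnd
    exact hnd.1
  · exact isPositive_singles hpieces (by rwa [hflat])
  · rw [List.toFinset_val, List.dedup_eq_self.2 hmap]

lemma IsDecomposition.eq_of_flatten_eq {S₁ : Finset α} {𝔮 : Finset (Finset α)}
    {E : List (List α)} (hD : IsDecomposition wt S₀ 𝔭 D) (hE : IsDecomposition wt S₁ 𝔮 E)
    (h : D.flatten = E.flatten) : S₀ = S₁ ∧ 𝔭 = 𝔮 ∧ D = E := by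
  have hDE : D = E := by
    obtain ⟨x, D, rfl⟩ := hD.head
    obtain ⟨y, E, rfl⟩ := hE.head
    simp only [List.flatten_cons, List.cons_append, List.nil_append, List.cons.injEq] at h
    rw [h.1, Passport.eq_of_flatten_eq (fun p hp => hD.isPiece p (by simp [hp]))
      (fun p hp => hE.isPiece p (by simp [hp])) (by simpa using hD.blockFree)
      (by simpa using hE.blockFree) h.2]
  subst hDE
  exact ⟨hD.isListing.2.symm.trans hE.isListing.2,
    Finset.val_injective (hD.map_blocks.symm.trans hE.map_blocks), rfl⟩

/-- Flattening identifies decompositions with positive orderings. -/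
noncomputable def flattenEquiv [Fintype α] [Nonempty α] (hwt : ∀ s, wt s ≠ 0)
    (hsum : ∑ s, wt s = 0) :
    (Σ S₀ : {S₀ : Finset α // S₀.Nonempty ∧ ∑ s ∈ S₀, wt s = 0},
      Σ 𝔭 : {𝔭 : Finset (Finset α) // IsPart wt (Finset.univ \ S₀.1) 𝔭},
        {D : List (List α) // IsDecomposition wt S₀.1 𝔭.1 D}) ≃
      {l : List α // IsListing Finset.univ l ∧ IsPositive wt l} := by
  refine Equiv.ofBijective (fun x => ⟨x.2.2.1.flatten,
    x.2.2.2.isListing_flatten x.2.1.2,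
    isPositive_flatten x.2.2.2.isPiece x.2.2.2.head x.2.2.2.last x.2.2.2.isPositive⟩) ⟨?_, ?_⟩
  · rintro ⟨⟨S₀, hS₀⟩, ⟨𝔭, h𝔭⟩, D, hD⟩ ⟨⟨S₁, hS₁⟩, ⟨𝔮, h𝔮⟩, E, hE⟩ h
    obtain ⟨rfl, rfl, rfl⟩ := hD.eq_of_flatten_eq hE (congrArg Subtype.val h)
    rfl
  · rintro ⟨l, hl, hpos⟩
    have hw : weight wt l = 0 := hl.weight_eq.trans hsum
    have hne : l ≠ [] := by
      rintro rfl
      exact Finset.univ_nonempty.ne_empty (by simpa using hl.2.symm)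
    obtain ⟨S₀, 𝔭, D, hD, rfl⟩ := exists_isDecomposition hwt hne hl.1 hw hpos
    refine ⟨⟨⟨S₀, ?_, ?_⟩, ⟨𝔭, hD.isPart hl⟩, D, hD⟩, rfl⟩
    · obtain ⟨x, M, rfl⟩ := hD.head
      exact ⟨x, by rw [← hD.isListing.2]; simp⟩
    · rw [← hD.isListing.weight_eq, ← weight_flatten hD.isPiece, hw]

end Flatten

end Passport

open Classical in
theorem stmt_8 {α : Type*} [Fintype α] (wt : α → ℝ)
    (hwt : ∀ s, wt s ≠ 0) (hsum : ∑ s, wt s = 0) (hcard : 2 ≤ Fintype.card α)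
    (hdec : ∃ A : Finset α, A.Nonempty ∧ A ≠ Finset.univ ∧ ∑ s ∈ A, wt s = 0) :
    numPos wt Finset.univ =
      numPosTree wt Finset.univ +
        ∑ S₀ ∈ Finset.univ.filter (fun S₀ : Finset α =>
            S₀.Nonempty ∧ S₀ ≠ Finset.univ ∧ ∑ s ∈ S₀, wt s = 0),
          numPosTree wt S₀ *
            ∑ 𝔭 ∈ Finset.univ.filter (IsPart wt (Finset.univ \ S₀)),
              (Nat.factorial (S₀.card + 𝔭.card - 2) / Nat.factorial (S₀.card - 2)) *
                ∏ B ∈ 𝔭, numPos wt B := by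
  have : Nonempty α := Fintype.card_pos_iff.1 (by omega)
  have hcount : ∀ S₀ : Finset α, S₀.Nonempty ∧ ∑ s ∈ S₀, wt s = 0 → ∀ 𝔭,
      IsPart wt (Finset.univ \ S₀) 𝔭 →
      Finite {D // Passport.IsDecomposition wt S₀ 𝔭 D} ∧
      Nat.card {D // Passport.IsDecomposition wt S₀ 𝔭 D} = numPosTree wt S₀ *
        ((Nat.factorial (S₀.card + 𝔭.card - 2) / Nat.factorial (S₀.card - 2)) *
          ∏ B ∈ 𝔭, numPos wt B) := by
    intro S₀ hS₀ 𝔭 h𝔭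
    have h2 := Passport.two_le_card_of_sum_eq_zero hwt hS₀.1 hS₀.2
    have h := Passport.card_decomposition hwt hS₀.1 hS₀.2
      (𝔭 := 𝔭) fun B hB => ⟨h𝔭.1 B hB, h𝔭.2.2.2 B hB⟩
    rwa [show S₀.card - 1 = S₀.card - 2 + 1 by omega, Nat.ascFactorial_eq_div,
      show S₀.card - 2 + 𝔭.card = S₀.card + 𝔭.card - 2 by omega] at h
  have hfin : ∀ (S₀ : {S₀ : Finset α // S₀.Nonempty ∧ ∑ s ∈ S₀, wt s = 0})
      (𝔭 : {𝔭 : Finset (Finset α) // IsPart wt (Finset.univ \ S₀.1) 𝔭}),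
      Finite {D : List (List α) // Passport.IsDecomposition wt S₀.1 𝔭.1 D} :=
    fun S₀ 𝔭 => (hcount S₀.1 S₀.2 𝔭.1 𝔭.2).1
  have htotal : numPos wt Finset.univ =
      ∑ S₀ ∈ Finset.univ.filter (fun S₀ : Finset α => S₀.Nonempty ∧ ∑ s ∈ S₀, wt s = 0),
        numPosTree wt S₀ * ∑ 𝔭 ∈ Finset.univ.filter (IsPart wt (Finset.univ \ S₀)),
          (Nat.factorial (S₀.card + 𝔭.card - 2) / Nat.factorial (S₀.card - 2)) *
            ∏ B ∈ 𝔭, numPos wt B := by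
    rw [Passport.numPos_eq, ← Nat.card_congr (Passport.flattenEquiv hwt hsum), Nat.card_sigma,
      Finset.sum_subtype _ (p := fun S₀ : Finset α => S₀.Nonempty ∧ ∑ s ∈ S₀, wt s = 0)
        (by simp)]
    refine Finset.sum_congr rfl fun S₀ _ => ?_
    rw [Nat.card_sigma, Finset.mul_sum,
      Finset.sum_subtype _ (p := IsPart wt (Finset.univ \ S₀.1)) (by simp)]
    exact Finset.sum_congr rfl fun 𝔭 _ => (hcount S₀.1 S₀.2 𝔭.1 𝔭.2).2
  have hempty : Finset.univ.filter (IsPart wt (∅ : Finset α)) = {∅} := by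
    ext 𝔭
    simp only [Finset.mem_filter, Finset.mem_univ, true_and, Finset.mem_singleton]
    constructor
    · rintro ⟨hne, hsub, -⟩
      refine Finset.eq_empty_of_forall_notMem fun B hB => (hne B hB).ne_empty ?_
      exact Finset.subset_empty.1 (hsub B hB)
    · rintro rfl
      simp [IsPart]
  have hinsert : Finset.univ.filter (fun S₀ : Finset α => S₀.Nonempty ∧ ∑ s ∈ S₀, wt s = 0) =
      insert Finset.univ (Finset.univ.filter fun S₀ : Finset α =>
        S₀.Nonempty ∧ S₀ ≠ Finset.univ ∧ ∑ s ∈ S₀, wt s = 0) := by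
    ext S₀
    by_cases h : S₀ = Finset.univ
    · simp [h, hsum]
    · simp [h]
  rw [htotal, hinsert, Finset.sum_insert (by simp), Finset.sdiff_self, hempty]
  simp [Nat.div_self (Nat.factorial_pos _)]
end

section
/- For any full passport (S, wt), the number of positive permutations satisfies |P_+| = Σ_{𝔭 ∈ 𝔓} (−1)^{|𝔭|−1} X(𝔭), where the sum ranges over all partitions of S into nonempty zero-sum blocks. -/
open Finset

/-- Every proper nonempty prefix of `l` has positive weight. -/
def IsPositiveList {α : Type*} (wt : α → ℝ) (l : List α) : Prop :=
  ∀ u v, l = u ++ v → u ≠ [] → v ≠ [] → 0 < (u.map wt).sum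

/-- The cut between `x` and `y` is the first minimum of the cumulative sums of `x ++ y`,
the final cumulative sum excluded. -/
def IsFirstMinCut {α : Type*} (wt : α → ℝ) (x y : List α) : Prop :=
  y ≠ [] ∧ (∀ u v, x = u ++ v → v ≠ [] → (x.map wt).sum < (u.map wt).sum) ∧
    ∀ u v, y = u ++ v → 0 ≤ (u.map wt).sum

/-- The linear orderings of a finite set, as lists. -/
def orderings {α : Type*} (T : Finset α) : Finset (List α) :=
  ⟨T.val.lists, Multiset.lists_nodup_finset T⟩

open Classical in
/-- The positive linear orderings of a finite set. -/
noncomputable def posOrderings {α : Type*} (wt : α → ℝ) (T : Finset α) : Finset (List α) :=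
  (orderings T).filter (IsPositiveList wt)

section Cuts

variable {α : Type*} {wt : α → ℝ}

theorem IsFirstMinCut.unique {x y x' y' : List α} (h : IsFirstMinCut wt x y)
    (h' : IsFirstMinCut wt x' y') (e : x ++ y = x' ++ y') : x = x' ∧ y = y' := by
  rcases List.append_eq_append_iff.1 e with ⟨a, rfl, rfl⟩ | ⟨a, rfl, rfl⟩
  · by_cases ha : a = []
    · simp [ha]
    · have h1 := h'.2.1 x a rfl ha
      have h2 := h.2.2 a y' rfl
      simp at h1; linarith
  · by_cases ha : a = []
    · simp [ha]
    · have h1 := h.2.1 x' a rfl ha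
      have h2 := h'.2.2 a y rfl
      simp at h1; linarith

theorem exists_isFirstMinCut {l : List α} (hl : l ≠ []) (hs : (l.map wt).sum = 0) :
    ∃ x y, l = x ++ y ∧ IsFirstMinCut wt x y := by
  have hpos : 0 < l.length := List.length_pos_iff.2 hl
  obtain ⟨k, hk, hmin⟩ := Finset.exists_min_image (Finset.range l.length)
    (fun k => toLex (((l.take k).map wt).sum, k)) ⟨0, by simpa using hpos⟩
  rw [Finset.mem_range] at hk
  have key : ∀ j < l.length, ((l.take k).map wt).sum < ((l.take j).map wt).sum ∨
      ((l.take k).map wt).sum = ((l.take j).map wt).sum ∧ k ≤ j := by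
    intro j hj
    simpa [Prod.Lex.le_iff] using hmin j (Finset.mem_range.2 hj)
  refine ⟨l.take k, l.drop k, by simp, by simpa using hk, ?_, ?_⟩
  · intro u v e hv
    have hlen := congrArg List.length e
    have hv' := List.length_pos_iff.2 hv
    rw [List.length_take, List.length_append] at hlen
    have hu : u = l.take u.length := by
      have := congrArg (List.take u.length) e
      rw [List.take_take, List.take_left, min_eq_left (by omega)] at this
      exact this.symm
    rcases key u.length (by omega) with h | ⟨-, h⟩
    · rwa [← hu] at h
    · omega
  · intro u v e
    have el : l = (l.take k ++ u) ++ v := by rw [List.append_assoc, ← e, List.take_append_drop]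
    have hu : l.take k ++ u = l.take (k + u.length) := by
      have := congrArg (List.take (l.take k ++ u).length) el
      rw [List.take_left, List.length_append, List.length_take, min_eq_left hk.le] at this
      exact this.symm
    have hsum : ((l.take k).map wt).sum + (u.map wt).sum
        = ((l.take (k + u.length)).map wt).sum := by
      rw [← hu]; simp
    rcases lt_or_ge (k + u.length) l.length with h | h
    · rcases key _ h with h' | ⟨h', -⟩ <;> linarith
    · rw [List.take_of_length_le h, hs] at hsum
      have := key 0 hpos
      simp only [List.take_zero, List.map_nil, List.sum_nil] at this
      rcases this with h' | ⟨h', -⟩ <;> linarith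

/-- A rotation of a positive list of weight zero is cut at its first minimum. -/
theorem IsPositiveList.isFirstMinCut {x y : List α} (h : IsPositiveList wt (y ++ x))
    (hs : ((y ++ x).map wt).sum = 0) (hy : y ≠ []) : IsFirstMinCut wt x y := by
  refine ⟨hy, ?_, ?_⟩
  · rintro u v rfl hv
    have := h (y ++ u) v (by simp) (by simp [hy]) hv
    simp at this hs ⊢
    linarith
  · rintro u v rfl
    by_cases hu : u = []
    · simp [hu]
    by_cases hv : v ++ x = []
    · simp at hv
      simp [hv] at hs ⊢
      exact hs.ge
    · exact (h u (v ++ x) (by simp) hu hv).le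

theorem IsFirstMinCut.isPositiveList {x y : List α} (h : IsFirstMinCut wt x y)
    (hs : ((x ++ y).map wt).sum = 0)
    (hy : ∀ u v, y = u ++ v → u ≠ [] → v ≠ [] → (u.map wt).sum ≠ 0) :
    IsPositiveList wt (y ++ x) := by
  intro u v e hu hv
  simp only [List.map_append, List.sum_append] at hs
  rcases List.append_eq_append_iff.1 e with ⟨a, rfl, rfl⟩ | ⟨a, rfl, rfl⟩
  · have := h.2.1 a v rfl hv
    simp only [List.map_append, List.sum_append] at this hs ⊢
    linarith
  · by_cases ha : a = []
    · subst ha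
      have := h.2.1 [] x rfl hv
      simp at this hs ⊢
      linarith
    · exact lt_of_le_of_ne (h.2.2 u a rfl) (hy u a rfl hu ha).symm

/-- Inserting a positive list of weight zero at the first minimum. -/
theorem IsFirstMinCut.insert {x y w : List α} (h : IsFirstMinCut wt x y)
    (hw : IsPositiveList wt w) (hs : (w.map wt).sum = 0) : IsFirstMinCut wt x (w ++ y) := by
  refine ⟨by simp [h.1], h.2.1, fun u v e => ?_⟩
  rcases List.append_eq_append_iff.1 e with ⟨a, rfl, rfl⟩ | ⟨a, rfl, rfl⟩
  · simpa [hs] using h.2.2 a v rfl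
  · by_cases hu : u = []
    · simp [hu]
    by_cases ha : a = []
    · subst ha
      simp at hs
      exact hs.ge
    · exact (hw u a rfl hu ha).le

/-- If a later minimum exists, the part up to the second minimum can be split off. -/
theorem IsFirstMinCut.exists_split {x y : List α} (h : IsFirstMinCut wt x y)
    (hy : ∃ u v, y = u ++ v ∧ u ≠ [] ∧ v ≠ [] ∧ (u.map wt).sum = 0) :
    ∃ w y', y = w ++ y' ∧ w ≠ [] ∧ (w.map wt).sum = 0 ∧ IsPositiveList wt w ∧
      IsFirstMinCut wt x y' := by
  classical
  have hex : ∃ n, ∃ u v, y = u ++ v ∧ u ≠ [] ∧ v ≠ [] ∧ (u.map wt).sum = 0 ∧ u.length = n := by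
    obtain ⟨u, v, h1, h2, h3, h4⟩ := hy
    exact ⟨_, u, v, h1, h2, h3, h4, rfl⟩
  obtain ⟨w, y', rfl, hw, hy', hs, hlen⟩ := Nat.find_spec hex
  refine ⟨w, y', rfl, hw, hs, ?_, hy', h.2.1, ?_⟩
  · rintro u v rfl hu hv
    refine lt_of_le_of_ne (h.2.2 u (v ++ y') (by simp)) fun h0 => ?_
    refine Nat.find_min hex (m := u.length) ?_
      ⟨u, v ++ y', by simp, hu, by simp [hv], h0.symm, rfl⟩
    rw [← hlen]
    simpa using List.length_pos_iff.2 hv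
  · rintro u v rfl
    simpa [hs] using h.2.2 (w ++ u) v (by simp)

theorem IsPositiveList.eq_of_append_eq {w w' y y' : List α} (h : IsPositiveList wt w)
    (h' : IsPositiveList wt w') (hs : (w.map wt).sum = 0) (hs' : (w'.map wt).sum = 0)
    (hw : w ≠ []) (hw' : w' ≠ []) (e : w ++ y = w' ++ y') : w = w' ∧ y = y' := by
  rcases List.append_eq_append_iff.1 e with ⟨a, rfl, rfl⟩ | ⟨a, rfl, rfl⟩
  · by_cases ha : a = []
    · simp [ha]
    · exact absurd hs (h' w a rfl hw ha).ne'
  · by_cases ha : a = []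
    · simp [ha]
    · exact absurd hs' (h w' a rfl hw' ha).ne'

end Cuts

section Counting

variable {α : Type*} {wt : α → ℝ}

theorem mem_orderings {T : Finset α} {l : List α} : l ∈ orderings T ↔ T.val = l :=
  Multiset.mem_lists_iff T.val l

theorem mem_posOrderings {T : Finset α} {l : List α} :
    l ∈ posOrderings wt T ↔ T.val = l ∧ IsPositiveList wt l := by
  simp [posOrderings, mem_orderings]

theorem card_orderings (T : Finset α) : (orderings T).card = T.card.factorial := by
  have h : T.val.lists = (T.toList.permutations : Multiset (List α)) := by
    rw [← Multiset.lists_coe, Finset.coe_toList]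
  rw [orderings, Finset.card_mk, h, Multiset.coe_card, List.length_permutations,
    Finset.length_toList]

theorem sum_map_of_val_eq {T : Finset α} {l : List α} (h : T.val = l) :
    (l.map wt).sum = ∑ s ∈ T, wt s := by
  rw [Finset.sum, h]; simp

theorem length_of_val_eq {T : Finset α} {l : List α} (h : T.val = l) :
    l.length = T.card := by
  rw [Finset.card, h]; simp

open Classical in
/-- The orderings of `T` that are rotations of positive orderings. -/
noncomputable def rotatedPosOrderings (wt : α → ℝ) (T : Finset α) : Finset (List α) :=
  (orderings T).filter fun l => ∃ x y, l = x ++ y ∧ y ≠ [] ∧ IsPositiveList wt (y ++ x)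

theorem card_rotatedPosOrderings {T : Finset α} (hs : ∑ s ∈ T, wt s = 0) :
    (rotatedPosOrderings wt T).card = (posOrderings wt T).card * T.card := by
  classical
  rw [← Finset.card_range T.card, ← Finset.card_product]
  symm
  have hcut : ∀ z ∈ posOrderings wt T, ∀ k < T.card,
      IsFirstMinCut wt (z.drop (k + 1)) (z.take (k + 1)) := by
    intro z hz k hk
    rw [mem_posOrderings] at hz
    have hlen := length_of_val_eq hz.1
    refine IsPositiveList.isFirstMinCut (by simpa using hz.2) ?_ ?_
    · rw [List.take_append_drop, sum_map_of_val_eq hz.1, hs]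
    · intro h
      have := congrArg List.length h
      simp at this
      subst this
      simp at hlen
      omega
  refine Finset.card_bij (fun p _ => p.1.drop (p.2 + 1) ++ p.1.take (p.2 + 1)) ?_ ?_ ?_
  · rintro ⟨z, k⟩ hp
    simp only [Finset.mem_product, Finset.mem_range] at hp
    have hc := hcut z hp.1 k hp.2
    have hz := mem_posOrderings.1 hp.1
    simp only [rotatedPosOrderings, Finset.mem_filter, mem_orderings]
    refine ⟨?_, _, _, rfl, hc.1, by simpa using hz.2⟩
    rw [hz.1]
    conv_lhs => rw [← List.take_append_drop (k + 1) z]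
    exact Multiset.coe_eq_coe.2 List.perm_append_comm
  · rintro ⟨z, k⟩ hp ⟨z', k'⟩ hp' e
    simp only [Finset.mem_product, Finset.mem_range] at hp hp'
    obtain ⟨h1, h2⟩ := (hcut z hp.1 k hp.2).unique (hcut z' hp'.1 k' hp'.2) e
    have hz : z = z' := by
      rw [← List.take_append_drop (k + 1) z, h1, h2, List.take_append_drop]
    have hl := length_of_val_eq (mem_posOrderings.1 hp.1).1
    have hl' := length_of_val_eq (mem_posOrderings.1 hp'.1).1
    have hk := congrArg List.length h2
    rw [List.length_take, List.length_take] at hk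
    exact Prod.ext hz (by simp only; omega)
  · intro l hl
    simp only [rotatedPosOrderings, Finset.mem_filter, mem_orderings] at hl
    obtain ⟨hl, x, y, rfl, hy, hp⟩ := hl
    have hlen := length_of_val_eq hl
    have hy' := List.length_pos_iff.2 hy
    rw [List.length_append] at hlen
    refine ⟨(y ++ x, y.length - 1), ?_, ?_⟩
    · simp only [Finset.mem_product, Finset.mem_range, mem_posOrderings]
      refine ⟨⟨?_, hp⟩, by omega⟩
      rw [hl]
      exact Multiset.coe_eq_coe.2 List.perm_append_comm
    · simp only
      rw [Nat.sub_add_cancel hy', List.drop_left, List.take_left]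

open Classical in
/-- The proper nonempty subsets of `T` of weight zero. -/
noncomputable def properZeroSum (wt : α → ℝ) (T : Finset α) : Finset (Finset α) :=
  T.ssubsets.filter fun W => W.Nonempty ∧ ∑ s ∈ W, wt s = 0

theorem sdiff_val_of_append [DecidableEq α] {T W : Finset α} {x w y : List α}
    (hT : T.val = ((x ++ (w ++ y) : List α) : Multiset α)) (hW : W.val = w) :
    (T \ W).val = ((x ++ y : List α) : Multiset α) := by
  rw [Finset.sdiff_val, hT, hW, ← Multiset.coe_add, ← Multiset.coe_add, ← Multiset.coe_add,
    add_left_comm, add_tsub_cancel_left]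

theorem val_append_of_sdiff [DecidableEq α] {T W : Finset α} {x w y : List α} (h : W ⊆ T)
    (hT : (T \ W).val = ((x ++ y : List α) : Multiset α)) (hW : W.val = w) :
    T.val = ((x ++ (w ++ y) : List α) : Multiset α) := by
  rw [← Multiset.coe_add, ← Multiset.coe_add, add_left_comm, Multiset.coe_add, ← hT, ← hW,
    Finset.sdiff_val, add_tsub_cancel_of_le (Finset.val_le_iff.2 h)]

open Classical in
theorem card_orderings_sdiff_rotatedPosOrderings {T : Finset α} (hs : ∑ s ∈ T, wt s = 0)
    (hT : T.Nonempty) :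
    (orderings T \ rotatedPosOrderings wt T).card =
      ∑ W ∈ properZeroSum wt T, (posOrderings wt W).card * (orderings (T \ W)).card := by
  have hcut : ∀ l : List α, ∃ p : List α × List α, l ≠ [] → (l.map wt).sum = 0 →
      l = p.1 ++ p.2 ∧ IsFirstMinCut wt p.1 p.2 := by
    intro l
    by_cases h : l ≠ [] ∧ (l.map wt).sum = 0
    · obtain ⟨x, y, h1, h2⟩ := exists_isFirstMinCut h.1 h.2
      exact ⟨(x, y), fun _ _ => ⟨h1, h2⟩⟩
    · exact ⟨([], []), fun h1 h2 => absurd ⟨h1, h2⟩ h⟩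
  choose cut hcut using hcut
  have hprop : ∀ {W : Finset α} {w u : List α}, W ∈ properZeroSum wt T →
      w ∈ posOrderings wt W → u ∈ orderings (T \ W) →
      (u = (cut u).1 ++ (cut u).2 ∧ IsFirstMinCut wt (cut u).1 (cut u).2) ∧
      W ⊆ T ∧ W.val = w ∧ w ≠ [] ∧ IsPositiveList wt w ∧ (w.map wt).sum = 0 ∧
      (T \ W).val = u := by
    intro W w u hW hw hu
    simp only [properZeroSum, Finset.mem_filter, Finset.mem_ssubsets] at hW
    rw [mem_posOrderings] at hw
    rw [mem_orderings] at hu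
    obtain ⟨hWT, hWne, hWs⟩ := hW
    refine ⟨hcut u ?_ ?_, hWT.1, hw.1, ?_, hw.2, ?_, hu⟩
    · rintro rfl
      rw [Multiset.coe_nil, Finset.val_eq_zero, Finset.sdiff_eq_empty_iff_subset] at hu
      exact hWT.2 hu
    · rw [sum_map_of_val_eq hu]
      have := Finset.sum_sdiff (f := wt) hWT.1
      linarith
    · rintro rfl
      exact hWne.ne_empty (by simpa using hw.1)
    · rw [sum_map_of_val_eq hw.1, hWs]
  simp_rw [← Finset.card_product]
  rw [← Finset.card_sigma]
  symm
  refine Finset.card_bij (fun p _ => (cut p.2.2).1 ++ (p.2.1 ++ (cut p.2.2).2)) ?_ ?_ ?_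
  · rintro ⟨W, w, u⟩ hp
    simp only [Finset.mem_sigma, Finset.mem_product] at hp
    obtain ⟨⟨hu, hc⟩, hWT, hW, hwne, hwp, hws, hTW⟩ := hprop hp.1 hp.2.1 hp.2.2
    rw [hu] at hTW
    simp only [Finset.mem_sdiff, rotatedPosOrderings, Finset.mem_filter, mem_orderings, not_and]
    refine ⟨val_append_of_sdiff hWT hTW hW, fun h => ?_⟩
    rintro ⟨x, y, e, hy, hpos⟩
    have hc' : IsFirstMinCut wt x y := by
      refine hpos.isFirstMinCut ?_ hy
      rw [← hs, ← sum_map_of_val_eq h, e]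
      simp [add_comm]
    obtain ⟨rfl, rfl⟩ := (hc.insert hwp hws).unique hc' e
    exact (hpos w ((cut u).2 ++ (cut u).1) (by simp) hwne (by simp [hc.1])).ne' hws
  · rintro ⟨W, w, u⟩ hp ⟨W', w', u'⟩ hp' e
    simp only [Finset.mem_sigma, Finset.mem_product] at hp hp'
    obtain ⟨⟨hu, hc⟩, hWT, hW, hwne, hwp, hws, hTW⟩ := hprop hp.1 hp.2.1 hp.2.2
    obtain ⟨⟨hu', hc'⟩, hWT', hW', hwne', hwp', hws', hTW'⟩ := hprop hp'.1 hp'.2.1 hp'.2.2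
    simp only at e
    obtain ⟨h1, h2⟩ := (hc.insert hwp hws).unique (hc'.insert hwp' hws') e
    obtain ⟨rfl, h3⟩ := hwp.eq_of_append_eq hwp' hws hws' hwne hwne' h2
    have hWW : W = W' := Finset.val_injective (hW.trans hW'.symm)
    have huu : u = u' := by rw [hu, hu', h1, h3]
    subst hWW huu
    rfl
  · intro l hl
    simp only [Finset.mem_sdiff, rotatedPosOrderings, Finset.mem_filter, mem_orderings,
      not_and] at hl
    obtain ⟨hl, hrot⟩ := hl
    specialize hrot hl
    have hls : (l.map wt).sum = 0 := by rw [sum_map_of_val_eq hl, hs]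
    obtain ⟨x, y, rfl, hc⟩ := exists_isFirstMinCut (wt := wt) (l := l)
      (by rintro rfl; exact hT.ne_empty (by simpa using hl)) hls
    have hex : ∃ u v, y = u ++ v ∧ u ≠ [] ∧ v ≠ [] ∧ (u.map wt).sum = 0 := by
      by_contra! hcon
      exact hrot ⟨x, y, rfl, hc.1, hc.isPositiveList hls hcon⟩
    obtain ⟨w, y', rfl, hwne, hws, hwp, hc'⟩ := hc.exists_split hex
    have hnd : (x ++ (w ++ y')).Nodup := by
      rw [← Multiset.coe_nodup, ← hl]; exact T.nodup
    have hwnd : w.Nodup := hnd.of_append_right.of_append_left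
    obtain ⟨W, hW⟩ : ∃ W : Finset α, W.val = w := ⟨⟨w, by simpa using hwnd⟩, rfl⟩
    have hTW := sdiff_val_of_append hl hW
    have hne : x ++ y' ≠ [] := by simp [hc'.1]
    have hsum : ((x ++ y').map wt).sum = 0 := by
      simp only [List.map_append, List.sum_append] at hls ⊢
      linarith
    have hcu := hcut (x ++ y') hne hsum
    obtain ⟨e1, e2⟩ := hcu.2.unique hc' hcu.1.symm
    refine ⟨⟨W, w, x ++ y'⟩, ?_, ?_⟩
    · simp only [Finset.mem_sigma, Finset.mem_product, mem_posOrderings, mem_orderings,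
        properZeroSum, Finset.mem_filter, Finset.mem_ssubsets]
      refine ⟨⟨⟨?_, fun h => ?_⟩, ?_, ?_⟩, ⟨hW, hwp⟩, hTW⟩
      · rw [← Finset.val_le_iff, hl, hW, ← Multiset.coe_add, ← Multiset.coe_add, add_left_comm]
        exact Multiset.le_add_right _ _
      · rw [Finset.sdiff_eq_empty_iff_subset.2 h] at hTW
        exact hne (Multiset.coe_eq_zero _ |>.1 hTW.symm)
      · rw [Finset.nonempty_iff_ne_empty]
        rintro rfl
        exact hwne (by simpa using hW.symm)
      · rw [← sum_map_of_val_eq hW, hws]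
    · simp only
      rw [e1, e2]

open Classical in
/-- The recursion for the number of positive orderings. -/
theorem factorial_eq_card_posOrderings {T : Finset α} (hs : ∑ s ∈ T, wt s = 0)
    (hT : T.Nonempty) :
    T.card.factorial = (posOrderings wt T).card * T.card +
      ∑ W ∈ properZeroSum wt T, (posOrderings wt W).card * (T \ W).card.factorial := by
  have h : rotatedPosOrderings wt T ⊆ orderings T := Finset.filter_subset _ _
  have h1 := Finset.card_sdiff_add_card_eq_card h
  rw [card_orderings_sdiff_rotatedPosOrderings hs hT, card_rotatedPosOrderings hs,
    card_orderings] at h1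
  simp_rw [card_orderings] at h1
  omega

end Counting

section Partitions

variable {α : Type*} {wt : α → ℝ}

theorem IsPart.eq_of_mem {T : Finset α} {𝔭 : Finset (Finset α)} (h : IsPart wt T 𝔭)
    {B C : Finset α} (hB : B ∈ 𝔭) (hC : C ∈ 𝔭) {a : α} (haB : a ∈ B) (haC : a ∈ C) : B = C :=
  (h.2.2.1 a (h.2.1 B hB haB)).unique ⟨hB, haB⟩ ⟨hC, haC⟩

theorem IsPart.sum_card {T : Finset α} {𝔭 : Finset (Finset α)} (h : IsPart wt T 𝔭) :
    ∑ B ∈ 𝔭, B.card = T.card := by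
  classical
  have hT : T = 𝔭.biUnion id := by
    ext a
    simp only [Finset.mem_biUnion, id]
    constructor
    · intro ha
      obtain ⟨B, hB, -⟩ := h.2.2.1 a ha
      exact ⟨B, hB⟩
    · rintro ⟨B, hB, ha⟩
      exact h.2.1 B hB ha
  rw [hT, Finset.card_biUnion]
  · rfl
  · intro B hB C hC hne
    exact Finset.disjoint_left.2 fun a haB haC => hne (h.eq_of_mem hB hC haB haC)

theorem isPart_empty {𝔭 : Finset (Finset α)} : IsPart wt ∅ 𝔭 ↔ 𝔭 = ∅ := by
  constructor
  · rintro ⟨h1, h2, -⟩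
    refine Finset.eq_empty_of_forall_notMem fun B hB => ?_
    exact (h1 B hB).ne_empty (Finset.subset_empty.1 (h2 B hB))
  · rintro rfl
    simp [IsPart]

theorem IsPart.erase [DecidableEq α] {T U : Finset α} {𝔭 : Finset (Finset α)}
    (h : IsPart wt T 𝔭) (hU : U ∈ 𝔭) : IsPart wt (T \ U) (𝔭.erase U) := by
  refine ⟨fun B hB => h.1 B (Finset.mem_of_mem_erase hB), fun B hB a ha => ?_, fun a ha => ?_,
    fun B hB => h.2.2.2 B (Finset.mem_of_mem_erase hB)⟩
  · rw [Finset.mem_erase] at hB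
    exact Finset.mem_sdiff.2 ⟨h.2.1 B hB.2 ha, fun haU => hB.1 (h.eq_of_mem hB.2 hU ha haU)⟩
  · rw [Finset.mem_sdiff] at ha
    obtain ⟨B, ⟨hB, haB⟩, -⟩ := h.2.2.1 a ha.1
    refine ⟨B, ⟨Finset.mem_erase.2 ⟨?_, hB⟩, haB⟩, ?_⟩
    · rintro rfl
      exact ha.2 haB
    · rintro C ⟨hC, haC⟩
      exact h.eq_of_mem (Finset.mem_of_mem_erase hC) hB haC haB

theorem IsPart.notMem_of_sdiff [DecidableEq α] {T W : Finset α} {𝔮 : Finset (Finset α)}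
    (h : IsPart wt W 𝔮) : T \ W ∉ 𝔮 := by
  intro hm
  obtain ⟨a, ha⟩ := h.1 _ hm
  exact (Finset.mem_sdiff.1 ha).2 (h.2.1 _ hm ha)

theorem IsPart.insert [DecidableEq α] {T W : Finset α} {𝔮 : Finset (Finset α)}
    (h : IsPart wt W 𝔮) (hWT : W ⊂ T) (hW : ∑ s ∈ W, wt s = 0) (hT : ∑ s ∈ T, wt s = 0) :
    IsPart wt T (insert (T \ W) 𝔮) := by
  refine ⟨fun B hB => ?_, fun B hB => ?_, fun a ha => ?_, fun B hB => ?_⟩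
  · rcases Finset.mem_insert.1 hB with rfl | hB
    · exact Finset.sdiff_nonempty.2 hWT.2
    · exact h.1 B hB
  · rcases Finset.mem_insert.1 hB with rfl | hB
    · exact Finset.sdiff_subset
    · exact (h.2.1 B hB).trans hWT.1
  · by_cases haW : a ∈ W
    · obtain ⟨B, ⟨hB, haB⟩, -⟩ := h.2.2.1 a haW
      refine ⟨B, ⟨Finset.mem_insert_of_mem hB, haB⟩, ?_⟩
      rintro C ⟨hC, haC⟩
      rcases Finset.mem_insert.1 hC with rfl | hC
      · exact absurd haW (Finset.mem_sdiff.1 haC).2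
      · exact h.eq_of_mem hC hB haC haB
    · refine ⟨T \ W, ⟨Finset.mem_insert_self _ _, Finset.mem_sdiff.2 ⟨ha, haW⟩⟩, ?_⟩
      rintro C ⟨hC, haC⟩
      rcases Finset.mem_insert.1 hC with rfl | hC
      · rfl
      · exact absurd (h.2.1 C hC haC) haW
  · rcases Finset.mem_insert.1 hB with rfl | hB
    · have := Finset.sum_sdiff (f := wt) hWT.1
      linarith
    · exact h.2.2.2 B hB

open Classical in
/-- The signed count of zero-sum partitions of `T`, each weighted by `X(𝔭)`. -/
noncomputable def signedPartSum [Fintype α] (wt : α → ℝ) (T : Finset α) : ℤ :=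
  ∑ 𝔭 ∈ Finset.univ.filter (IsPart wt T), (-1 : ℤ) ^ 𝔭.card * (Xval 𝔭 : ℤ)

theorem signedPartSum_empty [Fintype α] : signedPartSum wt ∅ = 1 := by
  classical
  have h : Finset.univ.filter (IsPart wt ∅) = {∅} := by
    ext 𝔭
    rw [Finset.mem_filter, isPart_empty]
    simp
  rw [signedPartSum]
  convert Finset.sum_singleton (fun 𝔭 : Finset (Finset α) => (-1 : ℤ) ^ 𝔭.card * (Xval 𝔭 : ℤ)) ∅
  simp [Xval]

open Classical in
theorem card_mul_signedPartSum [Fintype α] {T : Finset α} (hs : ∑ s ∈ T, wt s = 0) :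
    (T.card : ℤ) * signedPartSum wt T =
      -∑ W ∈ T.ssubsets.filter (fun W => ∑ s ∈ W, wt s = 0),
        signedPartSum wt W * ((T \ W).card.factorial : ℤ) := by
  have h1 : (T.card : ℤ) * signedPartSum wt T =
      ∑ 𝔭 ∈ Finset.univ.filter (IsPart wt T), ∑ U ∈ 𝔭,
        (U.card : ℤ) * ((-1 : ℤ) ^ 𝔭.card * (Xval 𝔭 : ℤ)) := by
    rw [signedPartSum, Finset.mul_sum]
    refine Finset.sum_congr rfl fun 𝔭 h𝔭 => ?_
    rw [← Finset.sum_mul, ← (Finset.mem_filter.1 h𝔭).2.sum_card]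
    push_cast
    rfl
  rw [h1, ← Finset.sum_neg_distrib]
  simp_rw [signedPartSum, Finset.sum_mul, ← Finset.sum_neg_distrib]
  rw [Finset.sum_sigma', Finset.sum_sigma']
  refine Finset.sum_bij' (fun p _ => ⟨T \ p.2, p.1.erase p.2⟩)
    (fun q _ => ⟨insert (T \ q.1) q.2, T \ q.1⟩) ?_ ?_ ?_ ?_ ?_
  · rintro ⟨𝔭, U⟩ hp
    simp only [Finset.mem_sigma, Finset.mem_filter, Finset.mem_univ, true_and,
      Finset.mem_ssubsets] at hp ⊢
    obtain ⟨h, hU⟩ := hp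
    refine ⟨⟨Finset.sdiff_ssubset (h.2.1 U hU) (h.1 U hU), ?_⟩, h.erase hU⟩
    have := Finset.sum_sdiff (f := wt) (h.2.1 U hU)
    have := h.2.2.2 U hU
    linarith
  · rintro ⟨W, 𝔮⟩ hq
    simp only [Finset.mem_sigma, Finset.mem_filter, Finset.mem_univ, true_and,
      Finset.mem_ssubsets] at hq ⊢
    exact ⟨hq.2.insert hq.1.1 hq.1.2 hs, Finset.mem_insert_self _ _⟩
  · rintro ⟨𝔭, U⟩ hp
    simp only [Finset.mem_sigma, Finset.mem_filter, Finset.mem_univ, true_and] at hp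
    have : T \ (T \ U) = U := Finset.sdiff_sdiff_eq_self (hp.1.2.1 U hp.2)
    simp only [this, Finset.insert_erase hp.2]
  · rintro ⟨W, 𝔮⟩ hq
    simp only [Finset.mem_sigma, Finset.mem_filter, Finset.mem_univ, true_and,
      Finset.mem_ssubsets] at hq
    have : T \ (T \ W) = W := Finset.sdiff_sdiff_eq_self hq.1.1.1
    simp only [this, Finset.erase_insert hq.2.notMem_of_sdiff]
  · rintro ⟨𝔭, U⟩ hp
    simp only [Finset.mem_sigma, Finset.mem_filter, Finset.mem_univ, true_and] at hp
    have hTU : T \ (T \ U) = U := Finset.sdiff_sdiff_eq_self (hp.1.2.1 U hp.2)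
    have hX : Xval 𝔭 = (U.card - 1).factorial * Xval (𝔭.erase U) :=
      (Finset.mul_prod_erase 𝔭 (fun B => (B.card - 1).factorial) hp.2).symm
    have hU : U.card.factorial = U.card * (U.card - 1).factorial :=
      (Nat.mul_factorial_pred (Finset.card_pos.2 (hp.1.1 U hp.2)).ne').symm
    simp only [hTU]
    rw [hX, hU, ← Finset.card_erase_add_one hp.2, pow_succ]
    push_cast
    ring

theorem card_posOrderings_eq_neg_signedPartSum [Fintype α] (T : Finset α) (hT : T.Nonempty)
    (hs : ∑ s ∈ T, wt s = 0) : ((posOrderings wt T).card : ℤ) = -signedPartSum wt T := by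
  classical
  induction T using Finset.strongInduction with
  | H T ih =>
    have h1 := congrArg (Nat.cast : ℕ → ℤ) (factorial_eq_card_posOrderings hs hT)
    have h2 := card_mul_signedPartSum hs
    have hins : T.ssubsets.filter (fun W => ∑ s ∈ W, wt s = 0) =
        insert ∅ (properZeroSum wt T) := by
      ext W
      rcases W.eq_empty_or_nonempty with rfl | hW
      · simpa using hT
      · simp [properZeroSum, hW, hW.ne_empty]
    rw [hins, Finset.sum_insert (by simp [properZeroSum]), signedPartSum_empty,
      Finset.sdiff_empty] at h2
    have h3 : ∑ W ∈ properZeroSum wt T, signedPartSum wt W * ((T \ W).card.factorial : ℤ) =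
        -∑ W ∈ properZeroSum wt T,
          ((posOrderings wt W).card : ℤ) * ((T \ W).card.factorial : ℤ) := by
      rw [← Finset.sum_neg_distrib]
      refine Finset.sum_congr rfl fun W hW => ?_
      simp only [properZeroSum, Finset.mem_filter, Finset.mem_ssubsets] at hW
      rw [ih W hW.1 hW.2.1 hW.2.2]
      ring
    push_cast at h1
    have hc : (T.card : ℤ) ≠ 0 := by exact_mod_cast hT.card_pos.ne'
    refine mul_left_cancel₀ hc ?_
    linarith

end Partitions

section Permutations

variable {α : Type*} {wt : α → ℝ}

/-- The list of the values of a linear ordering. -/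
def permToList (B : Finset α) (P : Fin B.card ≃ {x // x ∈ B}) : List α :=
  List.ofFn fun j => (P j : α)

theorem val_eq_permToList (B : Finset α) (P : Fin B.card ≃ {x // x ∈ B}) :
    B.val = permToList B P := by
  have hnd : (permToList B P).Nodup :=
    List.nodup_ofFn_ofInjective (Subtype.val_injective.comp P.injective)
  refine (Multiset.Nodup.ext B.nodup (Multiset.coe_nodup.2 hnd)).2 fun a => ?_
  rw [Multiset.mem_coe, permToList, List.mem_ofFn, Finset.mem_val]
  constructor
  · intro ha
    exact ⟨P.symm ⟨a, ha⟩, by simp⟩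
  · rintro ⟨j, rfl⟩
    exact (P j).2

theorem sum_take_ofFn (n : ℕ) (f : Fin n → α) (i : ℕ) :
    (((List.ofFn f).take i).map wt).sum =
      ∑ j ∈ Finset.univ.filter (fun j : Fin n => (j : ℕ) < i), wt (f j) := by
  rw [List.map_take, List.map_ofFn, List.sum_take_ofFn]
  rfl

theorem posPermOn_iff_isPositiveList (B : Finset α) (P : Fin B.card ≃ {x // x ∈ B}) :
    PosPermOn wt B P ↔ IsPositiveList wt (permToList B P) := by
  have hlen : (permToList B P).length = B.card := List.length_ofFn
  constructor
  · intro h u v e hu hv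
    have hu' := List.length_pos_iff.2 hu
    have hv' := List.length_pos_iff.2 hv
    rw [e, List.length_append] at hlen
    have := h u.length (by omega) (by omega)
    rwa [cumSumOn, ← sum_take_ofFn, ← permToList, e, List.take_left] at this
  · intro h i h1 h2
    rw [cumSumOn, ← sum_take_ofFn]
    refine h _ ((permToList B P).drop i) (List.take_append_drop _ _).symm ?_ ?_
    · rw [← List.length_pos_iff, List.length_take, List.length_ofFn]
      omega
    · rw [← List.length_pos_iff, List.length_drop, hlen]
      omega

theorem permToList_injective (B : Finset α) : Function.Injective (permToList B) := by
  intro P Q h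
  ext j
  exact congrFun (List.ofFn_injective h) j

theorem exists_permToList_eq {B : Finset α} {l : List α} (h : B.val = l) :
    ∃ P, permToList B P = l := by
  have hlen : B.card = l.length := (length_of_val_eq h).symm
  have hnd : l.Nodup := by
    rw [← Multiset.coe_nodup, ← h]; exact B.nodup
  have hmem : ∀ j : Fin B.card, l.get (j.cast hlen) ∈ B := fun j => by
    rw [← Finset.mem_val, h]; exact List.get_mem _ _
  have hinj : Function.Injective
      fun j : Fin B.card => (⟨l.get (j.cast hlen), hmem j⟩ : {x // x ∈ B}) := by
    intro j k e
    have := List.nodup_iff_injective_get.1 hnd (congrArg Subtype.val e)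
    simpa using this
  refine ⟨Equiv.ofBijective _
    ((Fintype.bijective_iff_injective_and_card _).2 ⟨hinj, by simp⟩), ?_⟩
  refine List.ext_get (by simp [permToList, hlen]) fun n h1 h2 => ?_
  simp [permToList]

theorem numPos_eq_card_posOrderings (B : Finset α) :
    numPos wt B = (posOrderings wt B).card := by
  rw [numPos, ← Nat.card_eq_finsetCard (posOrderings wt B)]
  refine Nat.card_eq_of_bijective (fun P => ⟨permToList B P.1, mem_posOrderings.2
    ⟨val_eq_permToList B P.1, (posPermOn_iff_isPositiveList B P.1).1 P.2⟩⟩) ⟨?_, ?_⟩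
  · intro P Q h
    exact Subtype.ext (permToList_injective B (congrArg Subtype.val h))
  · rintro ⟨l, hl⟩
    obtain ⟨hl, hp⟩ := mem_posOrderings.1 hl
    obtain ⟨P, rfl⟩ := exists_permToList_eq hl
    exact ⟨⟨P, (posPermOn_iff_isPositiveList B P).2 hp⟩, rfl⟩

end Permutations

open Classical in
theorem stmt_9 {α : Type*} [Fintype α] (wt : α → ℝ)
    (hwt : ∀ s, wt s ≠ 0) (hsum : ∑ s, wt s = 0) (hcard : 2 ≤ Fintype.card α) :
    (numPos wt Finset.univ : ℤ) =
      ∑ 𝔭 ∈ Finset.univ.filter (IsPart wt Finset.univ),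
        (-1 : ℤ) ^ (𝔭.card - 1) * (Xval 𝔭 : ℤ) := by
  have hne : (Finset.univ : Finset α).Nonempty := by
    rw [← Finset.card_pos, Finset.card_univ]
    omega
  rw [numPos_eq_card_posOrderings, card_posOrderings_eq_neg_signedPartSum _ hne hsum,
    signedPartSum, ← Finset.sum_neg_distrib]
  refine Finset.sum_congr rfl fun 𝔭 h𝔭 => ?_
  obtain ⟨a, ha⟩ := hne
  obtain ⟨B, ⟨hB, -⟩, -⟩ := (Finset.mem_filter.1 h𝔭).2.2.2.1 a ha
  obtain ⟨n, hn⟩ := Nat.exists_eq_add_one.2 (Finset.card_pos.2 ⟨B, hB⟩)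
  rw [hn, Nat.add_sub_cancel, pow_succ]
  ring
end

section
/- Let (S, wt) be a decomposable full passport with N = |S|. Let E_0 := min{|Σ_{s∈A} wt(s)| : A ⊆ S with Σ_{s∈A} wt(s) ≠ 0} and ε_0 := E_0/(N−1). Fix s_− ∈ S and a function ε : S → ℝ with 0 < ε(s) < ε_0 for all s ≠ s_− and ε(s_−) := −Σ_{s≠s_−} ε(s). Then: (1) |Σ_{s∈A} ε(s)| < E_0 for every subset A ⊆ S; (2) for every nonempty proper subset A ⊊ S, Σ_{s∈A} ε(s) ≠ 0, and Σ_{s∈A} ε(s) > 0 if and only if s_− ∉ A; (3) the perturbed weight w̃t := wt + ε satisfies Σ_{s∈S} w̃t(s) = 0 and Σ_{s∈A} w̃t(s) ≠ 0 for every nonempty proper subset A ⊊ S, so (S, w̃t) is a non-decomposable full passport. -/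
open Finset

/-- A nonempty sum of at most `n` reals, each below `E / n`, is below `E`. -/
theorem sum_lt_of_forall_lt_div {α : Type*} {A : Finset α} {f : α → ℝ} {E n : ℝ}
    (hA : A.Nonempty) (hE : 0 ≤ E) (hn : 0 < n) (hcard : (#A : ℝ) ≤ n)
    (hf : ∀ s ∈ A, f s < E / n) : ∑ s ∈ A, f s < E :=
  calc ∑ s ∈ A, f s < ∑ _s ∈ A, E / n := sum_lt_sum_of_nonempty hA hf
    _ = #A * (E / n) := by rw [sum_const, nsmul_eq_mul]
    _ ≤ n * (E / n) := by gcongr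
    _ = E := by field_simp

/-- If the total sum vanishes, the sum over the complement is the negative of the sum. -/
theorem sum_eq_neg_sum_compl {α : Type*} [Fintype α] [DecidableEq α] {f : α → ℝ}
    (hf : ∑ s, f s = 0) (A : Finset α) : ∑ s ∈ A, f s = -∑ s ∈ Aᶜ, f s := by
  linarith [sum_add_sum_compl A f]

theorem stmt_10 {α : Type*} [Fintype α] [DecidableEq α] (wt : α → ℝ)
    (hwt : ∀ s, wt s ≠ 0) (hsum : ∑ s, wt s = 0) (hcard : 2 ≤ Fintype.card α)
    (hdec : ∃ A : Finset α, A.Nonempty ∧ A ≠ Finset.univ ∧ ∑ s ∈ A, wt s = 0)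
    (E₀ : ℝ)
    (hE0min : ∀ A : Finset α, (∑ s ∈ A, wt s) ≠ 0 → E₀ ≤ |(∑ s ∈ A, wt s)|)
    (hE0mem : ∃ A : Finset α, (∑ s ∈ A, wt s) ≠ 0 ∧ |(∑ s ∈ A, wt s)| = E₀)
    (sneg : α) (ε : α → ℝ)
    (hε : ∀ s, s ≠ sneg → 0 < ε s ∧ ε s < E₀ / (Fintype.card α - 1))
    (hεneg : ε sneg = -∑ s ∈ Finset.univ.erase sneg, ε s) :
    (∀ A : Finset α, |(∑ s ∈ A, ε s)| < E₀) ∧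
    (∀ A : Finset α, A.Nonempty → A ≠ Finset.univ →
      ((∑ s ∈ A, ε s) ≠ 0 ∧ (0 < ∑ s ∈ A, ε s ↔ sneg ∉ A))) ∧
    ((∑ s, (wt s + ε s)) = 0 ∧ (∀ s, wt s + ε s ≠ 0) ∧
      (∀ A : Finset α, A.Nonempty → A ≠ Finset.univ → (∑ s ∈ A, (wt s + ε s)) ≠ 0)) := by
  have hE : 0 < E₀ := by
    obtain ⟨A, hA, rfl⟩ := hE0mem
    exact abs_pos.mpr hA
  have hn : (0 : ℝ) < Fintype.card α - 1 := by
    have : (2 : ℝ) ≤ Fintype.card α := by exact_mod_cast hcard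
    linarith
  have hεsum : ∑ s, ε s = 0 := by
    rw [← add_sum_erase univ ε (mem_univ sneg), hεneg, neg_add_cancel]
  have hpos : ∀ A : Finset α, A.Nonempty → sneg ∉ A → 0 < ∑ s ∈ A, ε s := fun A hA hs =>
    sum_pos (fun s hsA => (hε s (ne_of_mem_of_not_mem hsA hs)).1) hA
  have habs : ∀ A : Finset α, sneg ∉ A → |∑ s ∈ A, ε s| < E₀ := by
    intro A hs
    rcases A.eq_empty_or_nonempty with rfl | hA
    · simpa using hE
    rw [abs_of_pos (hpos A hA hs)]
    refine sum_lt_of_forall_lt_div hA hE.le hn ?_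
      fun s hsA => (hε s (ne_of_mem_of_not_mem hsA hs)).2
    have hlt : #A + 1 ≤ Fintype.card α := card_lt_univ_of_notMem hs
    have : (#A : ℝ) + 1 ≤ Fintype.card α := by exact_mod_cast hlt
    linarith
  have hbound : ∀ A : Finset α, |∑ s ∈ A, ε s| < E₀ := by
    intro A
    by_cases hs : sneg ∈ A
    · rw [sum_eq_neg_sum_compl hεsum, abs_neg]
      exact habs Aᶜ (by simpa using hs)
    · exact habs A hs
  have hsign : ∀ A : Finset α, A.Nonempty → A ≠ univ →
      (∑ s ∈ A, ε s) ≠ 0 ∧ (0 < ∑ s ∈ A, ε s ↔ sneg ∉ A) := by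
    intro A hA hAu
    by_cases hs : sneg ∈ A
    · have hc : Aᶜ.Nonempty := by
        rwa [nonempty_iff_ne_empty, ne_eq, compl_eq_empty_iff]
      have hneg : ∑ s ∈ A, ε s < 0 := by
        rw [sum_eq_neg_sum_compl hεsum]
        exact neg_neg_of_pos (hpos Aᶜ hc (by simpa using hs))
      exact ⟨hneg.ne, fun h => absurd h hneg.not_gt, fun h => absurd hs h⟩
    · have h := hpos A hA hs
      exact ⟨h.ne', fun _ => hs, fun _ => h⟩
  have hne : ∀ A : Finset α, A.Nonempty → A ≠ univ → ∑ s ∈ A, (wt s + ε s) ≠ 0 := by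
    intro A hA hAu h
    rw [sum_add_distrib] at h
    by_cases hw : ∑ s ∈ A, wt s = 0
    · exact (hsign A hA hAu).1 (by rwa [hw, zero_add] at h)
    · have hle := hE0min A hw
      rw [eq_neg_of_add_eq_zero_left h, abs_neg] at hle
      exact (hbound A).not_ge hle
  refine ⟨hbound, hsign, by rw [sum_add_distrib, hsum, hεsum, add_zero], fun s => ?_, hne⟩
  have hs : ({s} : Finset α) ≠ univ := by
    intro h
    have hcs := congrArg card h
    rw [card_singleton, card_univ] at hcs
    omega
  simpa using hne {s} (singleton_nonempty s) hs
end

section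
/- Let (S, wt) be a decomposable full passport and let w̃t = wt + ε be a perturbed weight constructed from E_0, ε_0, s_− and ε as in the perturbed-passport construction. Then |P_+(S, w̃t)| = Σ_{n≥1} Σ_{(S_1,…,S_n)} ∏_{i=1}^{n} |P_+(S_i, wt)|, where the inner sum ranges over all ordered tuples (S_1,…,S_n) of pairwise disjoint nonempty subsets of S with union S, with Σ_{s∈S_i} wt(s) = 0 for each i, and with s_− ∈ S_n. -/
open Finset

/-- An ordered tuple `(S_1, …, S_n)` of pairwise disjoint nonempty zero-sum
subsets covering the whole index set, whose last block contains `sneg`. -/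
def OrderedTupleTo {α : Type*} (wt : α → ℝ) (sneg : α) (n : ℕ)
    (f : Fin n → Finset α) : Prop :=
  (∀ i, (f i).Nonempty) ∧ (∀ i, ∑ s ∈ f i, wt s = 0) ∧
  (∀ i j, i ≠ j → Disjoint (f i) (f j)) ∧ (∀ a : α, ∃ i, a ∈ f i) ∧
  (∀ i : Fin n, (i : ℕ) = n - 1 → sneg ∈ f i)

/-- Every cumulative sum of `l` over a nonempty proper initial segment is positive. -/
def List.PosPath {α : Type*} (w : α → ℝ) (l : List α) : Prop :=
  ∀ q r, l = q ++ r → q ≠ [] → r ≠ [] → 0 < (q.map w).sum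

/-- A nonempty zero-sum list whose proper cumulative sums are all positive. -/
def List.IsExcursion {α : Type*} (w : α → ℝ) (l : List α) : Prop :=
  l ≠ [] ∧ (l.map w).sum = 0 ∧ l.PosPath w

theorem List.sum_map_flatten_eq_zero {α : Type*} {w : α → ℝ} {L : List (List α)}
    (h : ∀ p ∈ L, (p.map w).sum = 0) : (L.flatten.map w).sum = 0 := by
  induction L with
  | nil => simp
  | cons p L ih => simp_all

theorem List.IsExcursion.eq_of_flatten_eq {α : Type*} {w : α → ℝ} {L₁ L₂ : List (List α)}
    (h₁ : ∀ p ∈ L₁, p.IsExcursion w) (h₂ : ∀ p ∈ L₂, p.IsExcursion w)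
    (h : L₁.flatten = L₂.flatten) : L₁ = L₂ := by
  induction L₁ generalizing L₂ with
  | nil =>
    cases L₂ with
    | nil => rfl
    | cons p L => exact absurd (by simp_all) (h₂ p (by simp)).1
  | cons p₁ L₁ ih =>
    cases L₂ with
    | nil => exact absurd (by simp_all) (h₁ p₁ (by simp)).1
    | cons p₂ L₂ =>
      obtain ⟨hn₁, hs₁, hp₁⟩ := h₁ p₁ (by simp)
      obtain ⟨hn₂, hs₂, hp₂⟩ := h₂ p₂ (by simp)
      have key : p₁ = p₂ := by
        simp only [List.flatten_cons] at h
        rcases List.append_eq_append_iff.1 h with ⟨c, hc, -⟩ | ⟨c, hc, -⟩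
        · by_contra hne
          exact (hp₂ p₁ c hc hn₁ (by rintro rfl; simp_all)).ne' hs₁
        · by_contra hne
          exact (hp₁ p₂ c hc hn₂ (by rintro rfl; simp_all)).ne' hs₂
      subst key
      rw [ih (fun p hp => h₁ p (List.mem_cons_of_mem _ hp))
        (fun p hp => h₂ p (List.mem_cons_of_mem _ hp)) (by simpa using h)]

theorem List.exists_flatten_eq_of_nonneg {α : Type*} {w : α → ℝ} (l : List α)
    (hs : (l.map w).sum = 0) (hl : ∀ q r, l = q ++ r → 0 ≤ (q.map w).sum) :
    ∃ L : List (List α), (∀ p ∈ L, p.IsExcursion w) ∧ L.flatten = l := by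
  induction hn : l.length using Nat.strong_induction_on generalizing l with
  | _ n ih =>
    by_cases hnil : l = []
    · exact ⟨[], by simp, by simp [hnil]⟩
    by_cases hpos : l.PosPath w
    · exact ⟨[l], by simpa using ⟨hnil, hs, hpos⟩, by simp⟩
    simp only [List.PosPath, not_forall, not_lt] at hpos
    obtain ⟨q, r, rfl, hq, hr, hle⟩ := hpos
    have hq0 : (q.map w).sum = 0 := le_antisymm hle (hl q r rfl)
    have hr0 : (r.map w).sum = 0 := by simpa [hq0] using hs
    have hql := List.length_pos_iff.2 hq
    have hrl := List.length_pos_iff.2 hr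
    rw [List.length_append] at hn
    obtain ⟨L₁, h₁, rfl⟩ := ih q.length (by omega) q hq0
      (fun a b hab => hl a (b ++ r) (by simp [hab])) rfl
    obtain ⟨L₂, h₂, rfl⟩ := ih r.length (by omega) r hr0
      (fun a b hab => by
        simpa only [List.map_append, List.sum_append, hq0, zero_add] using
          hl (L₁.flatten ++ a) b (by simp [hab])) rfl
    refine ⟨L₁ ++ L₂, fun p hp => ?_, by simp⟩
    rcases List.mem_append.1 hp with hp | hp
    exacts [h₁ p hp, h₂ p hp]

theorem List.exists_of_flatten_eq_append {α : Type*} {L : List (List α)} {q r : List α}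
    (h : L.flatten = q ++ r) (hr : r ≠ []) :
    ∃ L₁ a b L₂, L = L₁ ++ (a ++ b) :: L₂ ∧ q = L₁.flatten ++ a ∧ b ≠ [] := by
  induction L generalizing q with
  | nil => simp_all
  | cons p L ih =>
    have step : ∀ c, L.flatten = c ++ r → q = p ++ c →
        ∃ L₁ a b L₂, p :: L = L₁ ++ (a ++ b) :: L₂ ∧ q = L₁.flatten ++ a ∧ b ≠ [] := by
      rintro c hc rfl
      obtain ⟨L₁, a, b, L₂, rfl, rfl, hb⟩ := ih hc
      exact ⟨p :: L₁, a, b, L₂, by simp, by simp, hb⟩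
    rw [List.flatten_cons] at h
    rcases List.append_eq_append_iff.1 h with ⟨c, hc, hF⟩ | ⟨c, hc, hF⟩
    · exact step c hF hc
    · by_cases hc0 : c = []
      · subst hc0
        exact step [] (by simpa using hF.symm) (by simpa using hc.symm)
      · exact ⟨[], q, c, L, by simp [hc], by simp, hc0⟩

open Classical in
/-- The positive orderings of `B`, written as lists. -/
noncomputable def posLists {α : Type*} (w : α → ℝ) (B : Finset α) : Finset (List α) :=
  (Multiset.lists B.val).toFinset.filter (List.PosPath w)

theorem mem_posLists {α : Type*} {w : α → ℝ} {B : Finset α} {l : List α} :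
    l ∈ posLists w B ↔ (l.Nodup ∧ ∀ a, a ∈ l ↔ a ∈ B) ∧ l.PosPath w := by
  simp only [posLists, Finset.mem_filter, Multiset.mem_toFinset, Multiset.mem_lists_iff]
  refine and_congr_left fun _ => ⟨fun h => ⟨?_, fun a => ?_⟩, fun ⟨hn, hm⟩ => ?_⟩
  · simpa [h] using B.nodup
  · rw [← Finset.mem_val, h]; simp
  · exact (Multiset.Nodup.ext B.nodup (by simpa using hn)).2 fun a => by simp [hm]

theorem cumSumOn_eq_sum_take {α : Type*} (w : α → ℝ) (B : Finset α)
    (P : Fin B.card ≃ {x // x ∈ B}) (i : ℕ) :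
    cumSumOn w B P i = (((List.ofFn fun j => (P j : α)).take i).map w).sum := by
  rw [List.map_take, List.map_ofFn, List.sum_take_ofFn]
  rfl

theorem posPermOn_iff {α : Type*} (w : α → ℝ) (B : Finset α) (P : Fin B.card ≃ {x // x ∈ B}) :
    PosPermOn w B P ↔ (List.ofFn fun j => (P j : α)).PosPath w := by
  constructor
  · intro h q r hqr hq hr
    have hlen := congrArg List.length hqr
    have hq' := List.length_pos_iff.2 hq
    have hr' := List.length_pos_iff.2 hr
    rw [List.length_ofFn, List.length_append] at hlen
    have := h q.length (by omega) (by omega)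
    rwa [cumSumOn_eq_sum_take, hqr, List.take_left'  rfl] at this
  · intro h i h1 h2
    rw [cumSumOn_eq_sum_take]
    refine h _ _ (List.take_append_drop i _).symm ?_ ?_
    · rw [← List.length_pos_iff, List.length_take, List.length_ofFn]; omega
    · rw [← List.length_pos_iff, List.length_drop, List.length_ofFn]; omega

theorem numPos_eq_card_posLists {α : Type*} (w : α → ℝ) (B : Finset α) :
    numPos w B = (posLists w B).card := by
  rw [numPos, ← Nat.card_eq_finsetCard (posLists w B)]
  refine Nat.card_eq_of_bijective
    (fun P => ⟨List.ofFn fun j => (P.1 j : α), mem_posLists.2 ⟨⟨?_, fun a => ?_⟩,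
      (posPermOn_iff w B P.1).1 P.2⟩⟩) ⟨fun P Q h => ?_, fun ⟨l, hl⟩ => ?_⟩
  · exact List.nodup_ofFn.2 (Subtype.val_injective.comp P.1.injective)
  · rw [List.mem_ofFn]
    exact ⟨fun ⟨j, hj⟩ => hj ▸ (P.1 j).2, fun ha => ⟨P.1.symm ⟨a, ha⟩, by simp⟩⟩
  · have := List.ofFn_injective (congrArg Subtype.val h)
    exact Subtype.ext (Equiv.ext fun j => Subtype.ext (congrFun this j))
  · obtain ⟨⟨hn, hm⟩, hp⟩ := mem_posLists.1 hl
    have hlen : B.card = l.length := by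
      classical
      rw [← List.toFinset_card_of_nodup hn]
      congr 1
      ext a
      simp [hm]
    let g : Fin B.card → {x // x ∈ B} := fun j =>
      ⟨l.get (Fin.cast hlen j), (hm _).1 (List.get_mem _ _)⟩
    have hg : Function.Injective g := fun i j hij =>
      Fin.cast_injective hlen (List.nodup_iff_injective_get.1 hn (congrArg Subtype.val hij))
    let P := Equiv.ofBijective g ((Fintype.bijective_iff_injective_and_card g).2 ⟨hg, by simp⟩)
    have hP : (List.ofFn fun j => (P j : α)) = l :=
      List.ext_get (by simp [hlen]) fun i h₁ h₂ => by simp [P, g]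
    exact ⟨⟨P, (posPermOn_iff w B P).2 (hP ▸ hp)⟩, Subtype.ext hP⟩

theorem sum_perturbed_pos_iff {α : Type*} [Fintype α] {wt ε : α → ℝ} {E₀ : ℝ} {sneg : α}
    (hcard : 2 ≤ Fintype.card α)
    (hmin : ∀ A : Finset α, (∑ s ∈ A, wt s) ≠ 0 → E₀ ≤ |(∑ s ∈ A, wt s)|)
    (hε : ∀ s, s ≠ sneg → 0 < ε s ∧ ε s < E₀ / (Fintype.card α - 1))
    (hε0 : ∑ s, ε s = 0) {A : Finset α} (hA : A.Nonempty) (hA' : A ≠ Finset.univ) :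
    0 < ∑ s ∈ A, (wt s + ε s) ↔
      0 < ∑ s ∈ A, wt s ∨ (∑ s ∈ A, wt s = 0 ∧ sneg ∉ A) := by
  classical
  have hN : (0 : ℝ) < Fintype.card α - 1 := by
    have : (2 : ℝ) ≤ Fintype.card α := by exact_mod_cast hcard
    linarith
  have bound : ∀ C : Finset α, C.Nonempty → sneg ∉ C →
      0 < ∑ s ∈ C, ε s ∧ ∑ s ∈ C, ε s < E₀ := by
    intro C hC hs
    have hne : ∀ s ∈ C, s ≠ sneg := fun s hsC h => hs (h ▸ hsC)
    have hpos : 0 < ∑ s ∈ C, ε s := Finset.sum_pos (fun s h => (hε s (hne s h)).1) hC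
    refine ⟨hpos, ?_⟩
    have hlt : ∑ s ∈ C, ε s < C.card * (E₀ / (Fintype.card α - 1)) := by
      rw [← nsmul_eq_mul, ← Finset.sum_const]
      exact Finset.sum_lt_sum_of_nonempty hC fun s h => (hε s (hne s h)).2
    have hle : (C.card : ℝ) ≤ Fintype.card α - 1 := by
      have : C.card < Fintype.card α :=
        Finset.card_lt_univ_of_notMem hs
      have : ((C.card + 1 : ℕ) : ℝ) ≤ Fintype.card α := by exact_mod_cast this
      push_cast at this
      linarith
    obtain ⟨c, hc⟩ := hC
    have hq : 0 < E₀ / (Fintype.card α - 1) :=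
      (hε c (hne c hc)).1.trans (hε c (hne c hc)).2
    calc _ < _ := hlt
      _ ≤ (Fintype.card α - 1) * (E₀ / (Fintype.card α - 1)) := by gcongr
      _ = E₀ := mul_div_cancel₀ _ hN.ne'
  rw [Finset.sum_add_distrib]
  have hwt : ∑ s ∈ A, wt s = 0 ∨ E₀ ≤ ∑ s ∈ A, wt s ∨ ∑ s ∈ A, wt s ≤ -E₀ := by
    by_cases h : ∑ s ∈ A, wt s = 0
    · exact Or.inl h
    · exact Or.inr ((le_abs.1 (hmin A h)).imp id fun h => by linarith)
  by_cases hs : sneg ∈ A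
  · obtain ⟨h1, h2⟩ := bound Aᶜ (by simpa [Finset.nonempty_iff_ne_empty] using hA') (by simpa)
    have := Finset.sum_add_sum_compl A ε
    simp only [hs, not_true, and_false, or_false]
    constructor
    · intro h
      linarith
    · intro h
      rcases hwt with h' | h' | h' <;> linarith
  · obtain ⟨h1, h2⟩ := bound A hA hs
    simp only [hs, not_false_eq_true, and_true]
    constructor
    · intro h
      rcases hwt with h' | h' | h'
      · exact Or.inr h'
      · exact Or.inl (by linarith)
      · linarith
    · rintro (h | h) <;> linarith

/-- Positivity of an ordering for the perturbed weight, in terms of the unperturbed weight. -/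
theorem posPath_perturbed_iff {α : Type*} [Fintype α] {wt ε : α → ℝ} {E₀ : ℝ} {sneg : α}
    (hcard : 2 ≤ Fintype.card α)
    (hmin : ∀ A : Finset α, (∑ s ∈ A, wt s) ≠ 0 → E₀ ≤ |(∑ s ∈ A, wt s)|)
    (hε : ∀ s, s ≠ sneg → 0 < ε s ∧ ε s < E₀ / (Fintype.card α - 1))
    (hε0 : ∑ s, ε s = 0) {l : List α} (hn : l.Nodup) :
    l.PosPath (fun s => wt s + ε s) ↔ ∀ q r, l = q ++ r → q ≠ [] → r ≠ [] →
      0 < (q.map wt).sum ∨ ((q.map wt).sum = 0 ∧ sneg ∉ q) := by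
  classical
  refine forall₅_congr fun q r hl hq hr => ?_
  subst hl
  obtain ⟨hqn, -, hd⟩ := List.nodup_append.1 hn
  obtain ⟨a, ha⟩ := List.exists_mem_of_ne_nil r hr
  have hne : q.toFinset ≠ Finset.univ := fun h =>
    hd a (List.mem_toFinset.1 (h ▸ Finset.mem_univ a)) a ha rfl
  have := sum_perturbed_pos_iff hcard hmin hε hε0 (by simpa using hq) hne
  rwa [List.sum_toFinset _ hqn, List.sum_toFinset _ hqn, List.mem_toFinset] at this

theorem OrderedTupleTo.le_card {α : Type*} [Fintype α] {wt : α → ℝ} {sneg : α} {n : ℕ}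
    {f : Fin n → Finset α} (hf : OrderedTupleTo wt sneg n f) : n ≤ Fintype.card α := by
  choose a ha using hf.1
  have : Function.Injective a := fun i j hij => by
    by_contra hne
    exact Finset.disjoint_left.1 (hf.2.2.1 i j hne) (ha i) (hij ▸ ha j)
  simpa using Fintype.card_le_of_injective a this

section OrderedTuple

variable {α : Type*} {wt : α → ℝ} {sneg : α} {n : ℕ} {f : Fin n → Finset α} {g : Fin n → List α}

theorem OrderedTupleTo.isExcursion (hf : OrderedTupleTo wt sneg n f)
    (hg : ∀ i, g i ∈ posLists wt (f i)) : ∀ p ∈ List.ofFn g, p.IsExcursion wt := by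
  classical
  intro p hp
  obtain ⟨i, rfl⟩ := (List.mem_ofFn' _ _).1 hp
  obtain ⟨⟨hn, hm⟩, hpos⟩ := mem_posLists.1 (hg i)
  refine ⟨?_, ?_, hpos⟩
  · obtain ⟨a, ha⟩ := hf.1 i
    exact List.ne_nil_of_mem ((hm a).2 ha)
  · rw [← List.sum_toFinset _ hn, ← hf.2.1 i]
    congr 1
    ext a
    simp [hm]

theorem OrderedTupleTo.nodup_flatten (hf : OrderedTupleTo wt sneg n f)
    (hg : ∀ i, g i ∈ posLists wt (f i)) : (List.ofFn g).flatten.Nodup := by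
  refine List.nodup_flatten.2 ⟨fun p hp => ?_, List.pairwise_ofFn.2 fun i j hij a hi hj => ?_⟩
  · obtain ⟨i, rfl⟩ := (List.mem_ofFn' _ _).1 hp
    exact (mem_posLists.1 (hg i)).1.1
  · exact Finset.disjoint_left.1 (hf.2.2.1 i j hij.ne)
      (((mem_posLists.1 (hg i)).1.2 a).1 hi) (((mem_posLists.1 (hg j)).1.2 a).1 hj)

theorem OrderedTupleTo.mem_flatten (hf : OrderedTupleTo wt sneg n f)
    (hg : ∀ i, g i ∈ posLists wt (f i)) (a : α) : a ∈ (List.ofFn g).flatten := by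
  obtain ⟨i, hi⟩ := hf.2.2.2.1 a
  exact List.mem_flatten.2 ⟨g i, (List.mem_ofFn' _ _).2 ⟨i, rfl⟩,
    ((mem_posLists.1 (hg i)).1.2 a).2 hi⟩

theorem OrderedTupleTo.mem_getLast (hf : OrderedTupleTo wt sneg n f)
    (hg : ∀ i, g i ∈ posLists wt (f i)) (h : List.ofFn g ≠ []) :
    sneg ∈ (List.ofFn g).getLast h := by
  rw [List.getLast_eq_getElem, List.getElem_ofFn]
  exact ((mem_posLists.1 (hg _)).1.2 _).2 (hf.2.2.2.2 _ (by simp))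

theorem OrderedTupleTo.sum_pos_or_notMem_of_flatten_eq_append (hf : OrderedTupleTo wt sneg n f)
    (hg : ∀ i, g i ∈ posLists wt (f i)) (q r : List α) (h : (List.ofFn g).flatten = q ++ r)
    (hr : r ≠ []) : 0 < (q.map wt).sum ∨ ((q.map wt).sum = 0 ∧ sneg ∉ q) := by
  have hexc := hf.isExcursion hg
  have hnd := hf.nodup_flatten hg
  have hlast := hf.mem_getLast hg
  obtain ⟨L₁, a, b, L₂, hL, rfl, hb⟩ := List.exists_of_flatten_eq_append h hr
  rw [hL] at hexc hnd
  simp only [hL] at hlast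
  have h₁ : (L₁.flatten.map wt).sum = 0 :=
    List.sum_map_flatten_eq_zero fun p hp => (hexc p (by simp [hp])).2.1
  rw [List.map_append, List.sum_append, h₁, zero_add]
  by_cases ha : a = []
  · subst ha
    refine Or.inr ⟨by simp, fun hs => ?_⟩
    have hl := hlast (by simp)
    rw [List.getLast_append_of_ne_nil _ (by simp)] at hl
    rw [List.flatten_append, List.nodup_append] at hnd
    exact hnd.2.2 sneg (by simpa using hs) sneg
      (List.mem_flatten.2 ⟨_, List.getLast_mem _, hl⟩) rfl
  · exact Or.inl ((hexc (a ++ b) (by simp)).2.2 a b rfl ha hb)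

end OrderedTuple

theorem exists_orderedTupleTo_of_flatten {α : Type*} {wt : α → ℝ} {sneg : α}
    {L : List (List α)} (hL : ∀ p ∈ L, p.IsExcursion wt) (hn : L.flatten.Nodup)
    (hm : ∀ a, a ∈ L.flatten)
    (hq : ∀ q r, L.flatten = q ++ r → q ≠ [] → r ≠ [] →
      0 < (q.map wt).sum ∨ ((q.map wt).sum = 0 ∧ sneg ∉ q)) :
    ∃ f : Fin L.length → Finset α,
      OrderedTupleTo wt sneg L.length f ∧ ∀ i, L.get i ∈ posLists wt (f i) := by
  classical
  obtain ⟨hnL, hdL⟩ := List.nodup_flatten.1 hn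
  refine ⟨fun i => (L.get i).toFinset, ⟨fun i => ?_, fun i => ?_, fun i j hij => ?_, fun a => ?_,
    fun i hi => ?_⟩, fun i => ?_⟩
  · simpa using (hL _ (List.get_mem L i)).1
  · rw [List.sum_toFinset _ (hnL _ (List.get_mem L i))]
    exact (hL _ (List.get_mem L i)).2.1
  · rw [List.disjoint_toFinset_iff_disjoint]
    rcases lt_or_gt_of_ne hij with h | h
    · exact List.pairwise_iff_get.1 hdL i j h
    · exact (List.pairwise_iff_get.1 hdL j i h).symm
  · obtain ⟨p, hp, ha⟩ := List.mem_flatten.1 (hm a)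
    obtain ⟨i, rfl⟩ := List.get_of_mem hp
    exact ⟨i, by simpa using ha⟩
  · have hne : L ≠ [] := by rintro rfl; exact i.elim0
    obtain ⟨L', p, rfl⟩ := (List.eq_nil_or_concat' L).resolve_left hne
    have hp : (L' ++ [p]).get i = p := by
      simp only [List.length_append, List.length_singleton, Nat.add_sub_cancel] at hi
      simp [hi]
    simp only [hp, List.mem_toFinset]
    have hs : sneg ∈ L'.flatten ++ p := by simpa using hm sneg
    refine (List.mem_append.1 hs).resolve_left fun h => ?_
    have h0 : (L'.flatten.map wt).sum = 0 :=
      List.sum_map_flatten_eq_zero fun p hp => (hL p (by simp [hp])).2.1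
    rcases hq L'.flatten p (by simp) (List.ne_nil_of_mem h) (hL p (by simp)).1 with h' | h'
    · exact h'.ne' h0
    · exact h'.2 h
  · exact mem_posLists.2 ⟨⟨hnL _ (List.get_mem L i), by simp⟩, (hL _ (List.get_mem L i)).2.2⟩

open Classical in
theorem stmt_12 {α : Type*} [Fintype α] (wt : α → ℝ)
    (hwt : ∀ s, wt s ≠ 0) (hsum : ∑ s, wt s = 0) (hcard : 2 ≤ Fintype.card α)
    (hdec : ∃ A : Finset α, A.Nonempty ∧ A ≠ Finset.univ ∧ ∑ s ∈ A, wt s = 0)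
    (E₀ : ℝ)
    (hE0min : ∀ A : Finset α, (∑ s ∈ A, wt s) ≠ 0 → E₀ ≤ |(∑ s ∈ A, wt s)|)
    (hE0mem : ∃ A : Finset α, (∑ s ∈ A, wt s) ≠ 0 ∧ |(∑ s ∈ A, wt s)| = E₀)
    (sneg : α) (ε : α → ℝ)
    (hε : ∀ s, s ≠ sneg → 0 < ε s ∧ ε s < E₀ / (Fintype.card α - 1))
    (hεneg : ε sneg = -∑ s ∈ Finset.univ.erase sneg, ε s) :
    numPos (fun s => wt s + ε s) Finset.univ =
      ∑ n ∈ Finset.range (Fintype.card α + 1),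
        ∑ f ∈ Finset.univ.filter (OrderedTupleTo wt sneg n),
          ∏ i, numPos wt (f i) := by
  have hε0 : ∑ s, ε s = 0 := by
    rw [← Finset.add_sum_erase _ _ (Finset.mem_univ sneg), hεneg, neg_add_cancel]
  simp only [numPos_eq_card_posLists, ← Fintype.card_piFinset, ← Finset.card_sigma]
  refine (Finset.card_bij (fun x _ => (List.ofFn x.2.2).flatten) ?_ ?_ ?_).symm
  · rintro ⟨n, f, g⟩ h
    simp only [Finset.mem_sigma, Finset.mem_filter, Fintype.mem_piFinset] at h
    obtain ⟨-, ⟨-, hf⟩, hg⟩ := h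
    have hn := hf.nodup_flatten hg
    exact mem_posLists.2 ⟨⟨hn, fun a => by simp only [hf.mem_flatten hg, Finset.mem_univ]⟩,
      (posPath_perturbed_iff hcard hE0min hε hε0 hn).2
        fun q r h _ hr => hf.sum_pos_or_notMem_of_flatten_eq_append hg q r h hr⟩
  · rintro ⟨n, f, g⟩ h ⟨n', f', g'⟩ h' heq
    simp only [Finset.mem_sigma, Finset.mem_filter, Fintype.mem_piFinset] at h h'
    obtain ⟨-, ⟨-, hf⟩, hg⟩ := h
    obtain ⟨-, ⟨-, hf'⟩, hg'⟩ := h'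
    have := List.ofFn_inj'.1 (List.IsExcursion.eq_of_flatten_eq (hf.isExcursion hg)
      (hf'.isExcursion hg') heq)
    cases this
    have : f = f' := funext fun i => Finset.ext fun a =>
      ((mem_posLists.1 (hg i)).1.2 a).symm.trans ((mem_posLists.1 (hg' i)).1.2 a)
    rw [this]
  · intro l hl
    obtain ⟨⟨hn, hm⟩, hp⟩ := mem_posLists.1 hl
    have hq := (posPath_perturbed_iff hcard hE0min hε hε0 hn).1 hp
    have hl0 : (l.map wt).sum = 0 := by
      rw [← List.sum_toFinset _ hn, ← hsum]
      congr 1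
      ext a
      simp [hm]
    obtain ⟨L, hL, rfl⟩ := List.exists_flatten_eq_of_nonneg l hl0 fun q r h => by
      by_cases hq0 : q = []
      · simp [hq0]
      by_cases hr0 : r = []
      · simp_all
      rcases hq q r h hq0 hr0 with h' | h'
      exacts [h'.le, h'.1.ge]
    obtain ⟨f, hf, hg⟩ := exists_orderedTupleTo_of_flatten hL hn (fun a => (hm a).2 (by simp)) hq
    refine ⟨⟨L.length, f, L.get⟩, ?_, by simp⟩
    simp only [Finset.mem_sigma, Finset.mem_filter, Fintype.mem_piFinset, Finset.mem_range]
    exact ⟨Nat.lt_succ_of_le hf.le_card, ⟨Finset.mem_univ _, hf⟩, hg⟩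
end
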